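/- arXiv:1308.6161 — 11 statements merged into one kernel-verified Lean document; each statement's English description precedes it below -/
import Mathlib

section
/- Let f₀ : ℝ → ℝ be a nonnegative, locally absolutely continuous, integrable function, not identically zero, with continuous integrable derivative f₀', and suppose f₀ is spectrally stable for all wavenumbers (for every k > 0, ε_{f₀'}(k,·) has no zero z with Im z > 0). Then f₀ is structurally unstable under W^{1,1}-small perturbations of the equilibrium: for every δ > 0 there exist a locally absolutely continuous function g : ℝ → ℝ with integrable derivative satisfying ∫_ℝ|g| + ∫_ℝ|g'| < δ, a wavenumber k > 0, and z ∈ ℂ with Im z > 0, such that ε_{f₀'+g'}(k,z) = 0. -/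
open MeasureTheory Filter

/-- The Vlasov-Poisson dispersion function `ε_g(k,z) = 1 + (1/k²) ∫ g(p)/(z−p) dp`. -/
noncomputable def eps (g : ℝ → ℝ) (k : ℝ) (z : ℂ) : ℂ :=
  1 + (1 / (k : ℂ) ^ 2) * ∫ p : ℝ, (g p : ℂ) / (z - p)

/-- `f` is locally absolutely continuous with (a.e.) derivative `f'`:
`f'` is locally integrable and the fundamental theorem of calculus holds. -/
def LocAbsCont (f f' : ℝ → ℝ) : Prop :=
  (∀ a b : ℝ, IntervalIntegrable f' MeasureTheory.volume a b) ∧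
  ∀ a b : ℝ, f b - f a = ∫ t in a..b, f' t

open Topology

/-- The Cauchy kernel `1 / (u + iy - p)` is integrable against integrable functions. -/
lemma integrable_div_cauchy {f : ℝ → ℝ} (hf : Integrable f) (u : ℝ) {y : ℝ} (hy : 0 < y) :
    Integrable fun p : ℝ => (f p : ℂ) / ((u : ℂ) + y * Complex.I - p) := by
  have hcont : Continuous fun p : ℝ => ((u : ℂ) + y * Complex.I - p)⁻¹ := by
    refine Continuous.inv₀ (by fun_prop) fun p h => hy.ne' ?_
    simpa using congrArg Complex.im h
  refine Integrable.mono' (hf.norm.mul_const y⁻¹)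
    ((hf.ofReal (𝕜 := ℂ)).1.mul hcont.aestronglyMeasurable) (ae_of_all _ fun p => ?_)
  rw [norm_div, Complex.norm_real, div_eq_mul_inv]
  gcongr
  simpa [abs_of_pos hy] using Complex.abs_im_le_norm ((u : ℂ) + y * Complex.I - p)

/-- The Cauchy transform of an integrable function is `o(1/y)` at height `y`, uniformly on
horizontal lines. -/
lemma exists_mul_norm_integral_div_cauchy_lt {f : ℝ → ℝ} (hf : Integrable f) {ε : ℝ}
    (hε : 0 < ε) :
    ∃ y : ℝ, 0 < y ∧ y ≤ 1 ∧
      ∀ u : ℝ, y * ‖∫ p : ℝ, (f p : ℂ) / ((u : ℂ) + y * Complex.I - p)‖ < ε := by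
  obtain ⟨η, hη, hball⟩ : ∃ η : ℝ, 0 < η ∧
      ∀ u : ℝ, ∫ p in Metric.closedBall u η, ‖f p‖ < ε / 2 := by
    have ht : Tendsto (fun q : ℝ × ℝ => ∫ p in Metric.closedBall q.2 q.1, ‖f p‖)
        (𝓝[>] 0 ×ˢ ⊤) (𝓝 0) := by
      refine hf.norm.tendsto_setIntegral_nhds_zero ?_
      have : Tendsto (fun q : ℝ × ℝ => ENNReal.ofReal (2 * q.1)) (𝓝[>] 0 ×ˢ ⊤) (𝓝 0) := by
        have h0 : Tendsto (fun η : ℝ => ENNReal.ofReal (2 * η)) (𝓝[>] 0) (𝓝 0) := by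
          have : Continuous fun η : ℝ => ENNReal.ofReal (2 * η) :=
            ENNReal.continuous_ofReal.comp (by fun_prop)
          simpa using (this.tendsto 0).mono_left nhdsWithin_le_nhds
        exact h0.comp tendsto_fst
      simpa [Function.comp_def, Real.volume_closedBall] using this
    have hev := ht.eventually (gt_mem_nhds (half_pos hε))
    rw [Filter.eventually_prod_iff] at hev
    obtain ⟨pa, hpa, pb, hpb, hab⟩ := hev
    obtain ⟨η, hη, hη0⟩ := (hpa.and self_mem_nhdsWithin).exists
    exact ⟨η, hη0, fun u => hab hη (Filter.eventually_top.1 hpb u)⟩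
  set N : ℝ := ∫ p, ‖f p‖
  have hN0 : 0 ≤ N := integral_nonneg fun _ => norm_nonneg _
  set y : ℝ := min 1 (η * (ε / 2) / (N + 1))
  have hy : 0 < y := lt_min one_pos (by positivity)
  have hyN : y / η * N ≤ ε / 2 := by
    have h1 : y * (N + 1) ≤ η * (ε / 2) := (le_div_iff₀ (by positivity)).1 (min_le_right _ _)
    rw [div_mul_eq_mul_div, div_le_iff₀ hη]
    nlinarith
  refine ⟨y, hy, min_le_left _ _, fun u => ?_⟩
  have hind : Integrable ((Metric.closedBall u η).indicator fun p => ‖f p‖) :=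
    hf.norm.indicator Metric.isClosed_closedBall.measurableSet
  calc y * ‖∫ p : ℝ, (f p : ℂ) / ((u : ℂ) + y * Complex.I - p)‖
      ≤ y * ∫ p : ℝ, ‖(f p : ℂ) / ((u : ℂ) + y * Complex.I - p)‖ := by
        gcongr
        exact norm_integral_le_integral_norm _
    _ = ∫ p : ℝ, y * ‖(f p : ℂ) / ((u : ℂ) + y * Complex.I - p)‖ :=
        (integral_const_mul _ _).symm
    _ ≤ ∫ p : ℝ, ((Metric.closedBall u η).indicator (fun p => ‖f p‖) p + y / η * ‖f p‖) := by
        refine integral_mono ((integrable_div_cauchy hf u hy).norm.const_mul y)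
          (hind.add (hf.norm.const_mul _)) fun p => ?_
        have him : y ≤ ‖(u : ℂ) + y * Complex.I - p‖ := by
          simpa [abs_of_pos hy] using Complex.abs_im_le_norm ((u : ℂ) + y * Complex.I - p)
        have hre : |u - p| ≤ ‖(u : ℂ) + y * Complex.I - p‖ := by
          simpa using Complex.abs_re_le_norm ((u : ℂ) + y * Complex.I - p)
        have hpos := hy.trans_le him
        simp only [norm_div, Complex.norm_real]
        rw [← mul_div_assoc, div_le_iff₀ hpos]
        by_cases hp : p ∈ Metric.closedBall u η
        · rw [Set.indicator_of_mem hp]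
          have : 0 ≤ y / η * ‖f p‖ * ‖(u : ℂ) + y * Complex.I - p‖ := by positivity
          nlinarith [norm_nonneg (f p)]
        · rw [Set.indicator_of_notMem hp, zero_add]
          have hlt : η ≤ ‖(u : ℂ) + y * Complex.I - p‖ := by
            rw [Metric.mem_closedBall, Real.dist_eq, abs_sub_comm] at hp
            exact (not_le.1 hp).le.trans hre
          calc y * ‖f p‖ = y / η * ‖f p‖ * η := by field_simp
            _ ≤ _ := by gcongr
    _ = (∫ p in Metric.closedBall u η, ‖f p‖) + y / η * N := by
        rw [integral_add hind (hf.norm.const_mul _), integral_const_mul,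
          integral_indicator Metric.isClosed_closedBall.measurableSet]
    _ < ε := by linarith [hball u]

/-- A continuous integrable real function with zero integral vanishes somewhere. -/
lemma Continuous.exists_eq_zero_of_integral_eq_zero {F : ℝ → ℝ} (hc : Continuous F)
    (hi : Integrable F) (h0 : ∫ x, F x = 0) : ∃ u, F u = 0 := by
  by_contra! hne
  have hsign : (∀ u, 0 < F u) ∨ ∀ u, F u < 0 := by
    rcases (hne 0).lt_or_gt with h | h
    · refine Or.inr fun u => lt_of_not_ge fun hu => ?_
      obtain ⟨x, hx⟩ := mem_range_of_exists_le_of_exists_ge hc ⟨0, h.le⟩ ⟨u, hu⟩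
      exact hne x hx
    · refine Or.inl fun u => lt_of_not_ge fun hu => ?_
      obtain ⟨x, hx⟩ := mem_range_of_exists_le_of_exists_ge hc ⟨u, hu⟩ ⟨0, h.le⟩
      exact hne x hx
  rcases hsign with h | h
  · exact (integral_pos_of_integrable_nonneg_nonzero hc hi (fun u => (h u).le) (hne 0)).ne' h0
  · have := integral_pos_of_integrable_nonneg_nonzero hc.neg hi.neg
      (fun u => by simpa using (h u).le) (neg_ne_zero.2 (hne 0))
    simp [integral_neg, h0] at this

/-- On each horizontal line in the upper half plane, the Cauchy transform of an integrable
function with zero integral is real somewhere. -/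
lemma exists_im_integral_div_cauchy_eq_zero {f : ℝ → ℝ} (hf : Integrable f)
    (h0 : ∫ p, f p = 0) {y : ℝ} (hy : 0 < y) :
    ∃ u : ℝ, (∫ p : ℝ, (f p : ℂ) / ((u : ℂ) + y * Complex.I - p)).im = 0 := by
  set P : ℝ → ℝ := fun x => -y / (x ^ 2 + y ^ 2) with hP
  have hPc : Continuous P := by
    refine Continuous.div (by fun_prop) (by fun_prop) fun x => ?_
    positivity
  have hPi : Integrable P := by
    have h := ((integrable_inv_one_add_sq.comp_div hy.ne').const_mul (-y⁻¹))
    refine h.congr (ae_of_all _ fun x => ?_)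
    simp only [hP]
    field_simp
    ring
  have hPb : BddAbove (Set.range fun x => ‖P x‖) := by
    refine ⟨y⁻¹, ?_⟩
    rintro _ ⟨x, rfl⟩
    have h2 : 0 < x ^ 2 + y ^ 2 := by positivity
    simp only [hP, norm_div, norm_neg, Real.norm_eq_abs, abs_of_pos hy, abs_of_pos h2]
    rw [div_le_iff₀ h2]
    field_simp
    nlinarith [sq_nonneg x]
  let L := ContinuousLinearMap.mul ℝ ℝ
  obtain ⟨u, hu⟩ := Continuous.exists_eq_zero_of_integral_eq_zero
    (hPb.continuous_convolution_right_of_integrable L hf hPc)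
    (hf.integrable_convolution L hPi) (by rw [integral_convolution L hf hPi, h0]; simp)
  refine ⟨u, ?_⟩
  rw [convolution_def] at hu
  rw [← hu]
  have := integral_im (𝕜 := ℂ) (integrable_div_cauchy hf u hy)
  simp only [RCLike.im_to_complex] at this
  rw [← this]
  refine integral_congr_ae (ae_of_all _ fun p => ?_)
  simp [L, hP, Complex.div_im, Complex.normSq_apply]
  ring

/-- The derivative of the bump `-1 / (1 + t²)`. -/
noncomputable def bumpDeriv (t : ℝ) : ℝ := 2 * t / (1 + t ^ 2) ^ 2

lemma hasDerivAt_neg_inv_one_add_sq (t : ℝ) :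
    HasDerivAt (fun t : ℝ => -(1 + t ^ 2)⁻¹) (bumpDeriv t) t := by
  have h := (((hasDerivAt_id t).pow 2).const_add 1).inv (by simp; positivity)
  refine h.neg.congr_deriv ?_
  simp [bumpDeriv]
  ring

lemma continuous_bumpDeriv : Continuous bumpDeriv :=
  Continuous.div (by fun_prop) (by fun_prop) fun t => by positivity

lemma integrable_of_continuous_of_abs_le_inv_one_add_sq {h : ℝ → ℝ} (hc : Continuous h)
    (hb : ∀ t, |h t| ≤ (1 + t ^ 2)⁻¹) : Integrable h :=
  integrable_inv_one_add_sq.mono' hc.aestronglyMeasurable (ae_of_all _ hb)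

lemma integrable_bumpDeriv : Integrable bumpDeriv := by
  refine integrable_of_continuous_of_abs_le_inv_one_add_sq continuous_bumpDeriv fun t => ?_
  rw [bumpDeriv, abs_div, abs_of_pos (by positivity : 0 < (1 + t ^ 2) ^ 2),
    div_le_iff₀ (by positivity)]
  field_simp
  rw [abs_le]
  constructor <;> nlinarith [sq_nonneg (t - 1), sq_nonneg (t + 1)]

/-- The Cauchy transform of the bump's derivative is negative at `i`. -/
lemma exists_integral_bumpDeriv_div_eq :
    ∃ κ : ℝ, 0 < κ ∧ ∫ t : ℝ, (bumpDeriv t : ℂ) / (Complex.I - t) = -(κ : ℂ) := by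
  set a : ℝ → ℝ := fun t => 2 * t ^ 2 / (1 + t ^ 2) ^ 3 with ha
  set b : ℝ → ℝ := fun t => 2 * t / (1 + t ^ 2) ^ 3 with hb
  have hac : Continuous a := Continuous.div (by fun_prop) (by fun_prop) fun t => by positivity
  have hbc : Continuous b := Continuous.div (by fun_prop) (by fun_prop) fun t => by positivity
  have hai : Integrable a := by
    refine integrable_of_continuous_of_abs_le_inv_one_add_sq hac fun t => ?_
    rw [abs_of_nonneg (by simp only [ha]; positivity), ha, div_le_iff₀ (by positivity)]
    field_simp
    nlinarith [sq_nonneg t, sq_nonneg (t ^ 2)]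
  have hbi : Integrable b := by
    refine integrable_of_continuous_of_abs_le_inv_one_add_sq hbc fun t => ?_
    rw [hb, abs_div, abs_of_pos (by positivity : 0 < (1 + t ^ 2) ^ 3),
      div_le_iff₀ (by positivity)]
    field_simp
    rw [abs_le]
    constructor <;> nlinarith [sq_nonneg (t - 1), sq_nonneg (t + 1), sq_nonneg (t ^ 2)]
  have hb0 : ∫ t, b t = 0 := by
    have h := integral_neg_eq_self b volume
    have h' : ∀ t, b (-t) = -b t := fun t => by simp only [hb]; ring
    simp only [h', integral_neg] at h
    linarith
  refine ⟨∫ t, a t, integral_pos_of_integrable_nonneg_nonzero (x := 1) hac hai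
    (fun t => by simp only [ha, Pi.zero_apply]; positivity) (by norm_num [ha]), ?_⟩
  have key : ∀ t : ℝ, (bumpDeriv t : ℂ) / (Complex.I - t) =
      -(a t : ℂ) - (b t : ℂ) * Complex.I := by
    intro t
    have h1 : Complex.I - (t : ℂ) ≠ 0 := fun h => by simpa using congrArg Complex.im h
    have h2 : (1 + (t : ℂ) ^ 2) ≠ 0 := by
      exact_mod_cast (by positivity : (1 + t ^ 2 : ℝ) ≠ 0)
    rw [div_eq_iff h1]
    simp only [bumpDeriv, ha, hb]
    push_cast
    field_simp
    ring_nf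
    simp only [Complex.I_sq]
    ring
  have hai' : Integrable fun t => -(a t : ℂ) := hai.ofReal.neg
  have hbi' : Integrable fun t => (b t : ℂ) * Complex.I := hbi.ofReal.mul_const _
  simp_rw [key]
  rw [integral_sub hai' hbi', integral_neg, integral_mul_const, integral_complex_ofReal,
    integral_complex_ofReal, hb0]
  simp

/-- Structural instability of every stable equilibrium under `W^{1,1}`-small
perturbations of the equilibrium. -/
theorem structural_instability_W11
    (f₀ f₀' : ℝ → ℝ)
    (hnn : ∀ p, 0 ≤ f₀ p)
    (hac : LocAbsCont f₀ f₀')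
    (hint : Integrable f₀)
    (hnz : f₀ ≠ 0)
    (hcont : Continuous f₀')
    (hint' : Integrable f₀')
    (hstab : ∀ k : ℝ, 0 < k → ∀ z : ℂ, 0 < z.im → eps f₀' k z ≠ 0) :
    ∀ δ : ℝ, 0 < δ →
      ∃ g g' : ℝ → ℝ,
        LocAbsCont g g' ∧ Integrable g ∧ Integrable g' ∧
        (∫ p : ℝ, |g p|) + (∫ p : ℝ, |g' p|) < δ ∧
        ∃ k : ℝ, 0 < k ∧ ∃ z : ℂ, 0 < z.im ∧
          eps (fun p => f₀' p + g' p) k z = 0 := by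
  intro δ hδ
  obtain ⟨κ, hκ, hbump⟩ := exists_integral_bumpDeriv_div_eq
  have hderiv : ∀ x, HasDerivAt f₀ (f₀' x) x := fun x => by
    have h1 := (intervalIntegral.integral_hasDerivAt_right (hac.1 0 x)
      (hcont.stronglyMeasurableAtFilter _ _) hcont.continuousAt).const_add (f₀ 0)
    refine h1.congr_of_eventuallyEq (Eventually.of_forall fun b => ?_)
    linarith [hac.2 0 b]
  have hzero : ∫ p, f₀' p = 0 := integral_eq_zero_of_hasDerivAt_of_integrable hderiv hint' hint
  set A : ℝ := ∫ t : ℝ, |-(1 + t ^ 2)⁻¹|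
  set B : ℝ := ∫ t : ℝ, |bumpDeriv t| with hB
  have hA0 : 0 ≤ A := integral_nonneg fun _ => abs_nonneg _
  have hB0 : 0 ≤ B := integral_nonneg fun _ => abs_nonneg _
  obtain ⟨c, hc, hcδ⟩ : ∃ c : ℝ, 0 < c ∧ c * (A + B) < δ := by
    refine ⟨δ / (A + B + 1), by positivity, ?_⟩
    rw [div_mul_eq_mul_div, div_lt_iff₀ (by positivity)]
    nlinarith
  obtain ⟨y, hy, hy1, hsmall⟩ := exists_mul_norm_integral_div_cauchy_lt hint' (mul_pos hc hκ)
  obtain ⟨u, hu⟩ := exists_im_integral_div_cauchy_eq_zero hint' hzero hy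
  set g : ℝ → ℝ := fun p => c * -(1 + ((p - u) / y) ^ 2)⁻¹ with hg
  set g' : ℝ → ℝ := fun p => c / y * bumpDeriv ((p - u) / y) with hg'
  have hgc' : Continuous g' :=
    continuous_const.mul (continuous_bumpDeriv.comp (by fun_prop))
  have hgi' : Integrable g' :=
    ((integrable_bumpDeriv.comp_div hy.ne').comp_sub_right u).const_mul _
  have hgi : Integrable g :=
    ((integrable_inv_one_add_sq.neg.comp_div hy.ne').comp_sub_right u).const_mul _
  have hgd : ∀ p, HasDerivAt g (g' p) p := fun p => by
    have h1 : HasDerivAt (fun p : ℝ => (p - u) / y) (1 / y) p :=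
      ((hasDerivAt_id p).sub_const u).div_const y
    refine (((hasDerivAt_neg_inv_one_add_sq ((p - u) / y)).comp p h1).const_mul c).congr_deriv ?_
    simp only [hg']
    ring
  have hscale : ∀ {E : Type} [NormedAddCommGroup E] [NormedSpace ℝ E] (h : ℝ → E),
      ∫ p, h ((p - u) / y) = y • ∫ t, h t := fun h => by
    rw [integral_sub_right_eq_self (fun p => h (p / y)) u, Measure.integral_comp_div,
      abs_of_pos hy]
  have hgnorm : ∫ p, |g p| = c * (y * A) := by
    simp only [hg, abs_mul, abs_of_pos hc, integral_const_mul]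
    rw [hscale fun t => |-(1 + t ^ 2)⁻¹|, smul_eq_mul]
  have hgnorm' : ∫ p, |g' p| = c * B := by
    simp only [hg', abs_mul, abs_of_pos (div_pos hc hy), integral_const_mul]
    rw [hscale fun t => |bumpDeriv t|, smul_eq_mul, ← hB]
    field_simp
  have hgtransform : ∫ p : ℝ, (g' p : ℂ) / ((u : ℂ) + y * Complex.I - p) =
      ((-(c * κ / y) : ℝ) : ℂ) := by
    have hyC : (y : ℂ) ≠ 0 := by exact_mod_cast hy.ne'
    have hpt : ∀ p : ℝ, (g' p : ℂ) / ((u : ℂ) + y * Complex.I - p) =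
        (c / y ^ 2 : ℂ) *
          ((bumpDeriv ((p - u) / y) : ℂ) / (Complex.I - ((p - u) / y : ℝ))) := by
      intro p
      have : (u : ℂ) + y * Complex.I - p = y * (Complex.I - ((p - u) / y : ℝ)) := by
        push_cast
        field_simp
        ring
      rw [this]
      simp only [hg', Complex.ofReal_mul, Complex.ofReal_div]
      simp only [div_eq_mul_inv, mul_inv]
      ring
    simp_rw [hpt]
    rw [integral_const_mul, hscale fun t : ℝ => (bumpDeriv t : ℂ) / (Complex.I - t), hbump,
      Complex.real_smul]
    push_cast
    field_simp
  set F : ℂ := ∫ p : ℝ, (f₀' p : ℂ) / ((u : ℂ) + y * Complex.I - p) with hF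
  have hFre : F = (F.re : ℂ) := Complex.ext rfl (by simpa using hu)
  have hneg : 0 < c * κ / y - F.re := by
    rw [sub_pos, lt_div_iff₀ hy]
    have := hsmall u
    nlinarith [Complex.re_le_norm F]
  refine ⟨g, g', ⟨fun a b => hgc'.intervalIntegrable a b, fun a b => ?_⟩, hgi, hgi', ?_,
    √(c * κ / y - F.re), Real.sqrt_pos.2 hneg, (u : ℂ) + y * Complex.I, by simpa using hy, ?_⟩
  · exact (intervalIntegral.integral_eq_sub_of_hasDerivAt (fun p _ => hgd p)
      (hgc'.intervalIntegrable a b)).symm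
  · rw [hgnorm, hgnorm']
    have : y * A ≤ A := mul_le_of_le_one_left hA0 hy1
    nlinarith
  · have hsum : ∫ p : ℝ, ((f₀' p + g' p : ℝ) : ℂ) / ((u : ℂ) + y * Complex.I - p) =
        ((-(c * κ / y - F.re) : ℝ) : ℂ) := by
      simp_rw [Complex.ofReal_add, add_div]
      rw [integral_add (integrable_div_cauchy hint' u hy) (integrable_div_cauchy hgi' u hy),
        hgtransform, ← hF, hFre]
      push_cast
      simp
      ring
    rw [eps, hsum, ← Complex.ofReal_pow, Real.sq_sqrt hneg.le]
    have : ((c * κ / y - F.re : ℝ) : ℂ) ≠ 0 := by exact_mod_cast hneg.ne'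
    rw [Complex.ofReal_neg, mul_neg, one_div_mul_cancel this, add_neg_cancel]
end

section
/- Let f₀ : ℝ → ℝ be a nonnegative, integrable C¹ function with integrable derivative f₀', and suppose f₀'(p) = 0 for exactly one point p = q₀. Then f₀ is structurally stable under dynamically accessible (rearrangement) perturbations: for every strictly increasing C¹ diffeomorphism p̂ : ℝ → ℝ with p̂' > 0 everywhere, every k ≠ 0, and every z ∈ ℂ with Im z > 0, the rearranged equilibrium g = f₀ ∘ p̂ satisfies ε_{g'}(k,z) ≠ 0. -/
open MeasureTheory Filter

/-- A nonnegative integrable function without critical points on `(-∞, q)` is increasing there. -/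
lemma deriv_nonneg_of_integrable_of_deriv_ne_zero {f : ℝ → ℝ} {q : ℝ} (hnn : ∀ p, 0 ≤ f p)
    (hint : Integrable f) (hf : Differentiable ℝ f) (hne : ∀ x < q, deriv f x ≠ 0)
    {x : ℝ} (hx : x < q) : 0 ≤ deriv f x := by
  rcases hasDerivWithinAt_forall_lt_or_forall_gt_of_forall_ne (m := 0) (convex_Iio q)
    (fun y _ => (hf y).hasDerivAt.hasDerivWithinAt) hne with h | h
  · exfalso
    have hanti : StrictAntiOn f (Set.Iio q) :=
      strictAntiOn_of_deriv_neg (convex_Iio q) hf.continuous.continuousOn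
        (by simpa using h)
    obtain ⟨y, hxy, hyq⟩ := exists_between hx
    have hpos : 0 < f x := (hnn y).trans_lt (hanti hx hyq hxy)
    have hfin := hint.measure_ge_lt_top hpos
    have hsub : Set.Iic x ⊆ {a | f x ≤ f a} := fun a ha =>
      hanti.antitoneOn (lt_of_le_of_lt ha hx) hx ha
    have htop := measure_mono (μ := volume) hsub
    rw [Real.volume_Iic, top_le_iff] at htop
    exact hfin.ne htop
  · exact (h x hx).le

/-- A nonnegative integrable function with no critical point besides `q` increases before `q` and
decreases after it. -/
lemma deriv_mul_sub_nonneg_of_integrable {f : ℝ → ℝ} {q : ℝ} (hnn : ∀ p, 0 ≤ f p)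
    (hint : Integrable f) (hf : Differentiable ℝ f) (hne : ∀ x ≠ q, deriv f x ≠ 0) (x : ℝ) :
    0 ≤ deriv f x * (q - x) := by
  rcases lt_trichotomy x q with hx | rfl | hx
  · exact mul_nonneg (deriv_nonneg_of_integrable_of_deriv_ne_zero hnn hint hf
      (fun y hy => hne y hy.ne) hx) (sub_nonneg.2 hx.le)
  · simp
  · have h := deriv_nonneg_of_integrable_of_deriv_ne_zero (f := fun y => f (-y)) (q := -q)
      (fun p => hnn _) hint.comp_neg (hf.comp differentiable_neg)
      (fun y hy => by
        rw [deriv_comp_neg]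
        exact neg_ne_zero.2 (hne _ (by linarith [hy] : q < -y).ne'))
      (neg_lt_neg hx)
    rw [deriv_comp_neg, neg_neg] at h
    exact mul_nonneg_of_nonpos_of_nonpos (by linarith) (by linarith)

/-- Penrose's criterion: if `g` changes sign only once, from positive to negative, then the
dispersion function has no zero in the upper half plane. -/
lemma eps_ne_zero_of_mul_sub_nonneg {g : ℝ → ℝ} {q : ℝ} (hg : ∀ p, 0 ≤ g p * (q - p))
    {k : ℝ} (hk : k ≠ 0) {z : ℂ} (hz : 0 < z.im) : eps g k z ≠ 0 := by
  intro h
  unfold eps at h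
  by_cases hI : Integrable fun p : ℝ => (g p : ℂ) / (z - p)
  · set c : ℂ := ⟨1, (q - z.re) / z.im⟩ with hc
    have hkC : (k : ℂ) ^ 2 ≠ 0 := pow_ne_zero 2 (by exact_mod_cast hk)
    have hval : ∫ p : ℝ, (g p : ℂ) / (z - p) = -((k ^ 2 : ℝ) : ℂ) := by
      push_cast
      rw [one_div] at h
      linear_combination (k : ℂ) ^ 2 * h
        - (∫ p : ℝ, (g p : ℂ) / (z - p)) * mul_inv_cancel₀ hkC
    have hre : (∫ p : ℝ, c * ((g p : ℂ) / (z - p))).re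
        = ∫ p : ℝ, (c * ((g p : ℂ) / (z - p))).re :=
      (integral_re (hI.const_mul c)).symm
    have hnonneg : 0 ≤ ∫ p : ℝ, (c * ((g p : ℂ) / (z - p))).re := by
      refine integral_nonneg fun p => ?_
      have hp : (c * ((g p : ℂ) / (z - p))).re
          = g p * (q - p) / Complex.normSq (z - p) := by
        simp only [hc, Complex.mul_re, Complex.div_re, Complex.div_im, Complex.ofReal_re,
          Complex.ofReal_im, Complex.sub_re, Complex.sub_im]
        field_simp
        ring
      simpa only [hp, Pi.zero_apply] using div_nonneg (hg p) (Complex.normSq_nonneg _)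
    rw [← hre, integral_const_mul, hval] at hnonneg
    have hkpos : 0 < k ^ 2 := by positivity
    rw [← Complex.ofReal_neg, Complex.re_mul_ofReal] at hnonneg
    simp only [hc] at hnonneg
    linarith
  · simp [integral_undef hI] at h

/-- An equilibrium with a single critical point is structurally stable under
dynamically accessible (monotone rearrangement) perturbations. -/
theorem structural_stability_dynamically_accessible
    (f₀ : ℝ → ℝ) (q₀ : ℝ)
    (hnn : ∀ p, 0 ≤ f₀ p)
    (hint : Integrable f₀)
    (hC1 : ContDiff ℝ 1 f₀)
    (hint' : Integrable (deriv f₀))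
    (hcrit : {p : ℝ | deriv f₀ p = 0} = {q₀}) :
    ∀ phat : ℝ → ℝ,
      ContDiff ℝ 1 phat → Function.Bijective phat →
      (∀ p, 0 < deriv phat p) → StrictMono phat →
      ∀ k : ℝ, k ≠ 0 → ∀ z : ℂ, 0 < z.im →
        eps (deriv (f₀ ∘ phat)) k z ≠ 0 := by
  intro phat hphat hbij hpos hmono k hk z hz
  obtain ⟨q, rfl⟩ := hbij.surjective q₀
  have hf : Differentiable ℝ f₀ := hC1.differentiable one_ne_zero
  have hsign := deriv_mul_sub_nonneg_of_integrable hnn hint hf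
    fun x hx h0 => hx (hcrit.subset h0)
  refine eps_ne_zero_of_mul_sub_nonneg (q := q) (fun p => ?_) hk hz
  rw [deriv_comp p (hf _) (hphat.differentiable one_ne_zero p)]
  have hp := hsign (phat p)
  have hd := (hpos p).le
  rcases lt_trichotomy p q with h | rfl | h
  · have := nonneg_of_mul_nonneg_left hp (sub_pos.2 (hmono h))
    exact mul_nonneg (mul_nonneg this hd) (sub_nonneg.2 h.le)
  · simp
  · have h1 : deriv f₀ (phat p) ≤ 0 := by
      by_contra! h2
      exact absurd hp (not_le.2 (mul_neg_of_pos_of_neg h2 (sub_neg.2 (hmono h))))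
    exact mul_nonneg_of_nonpos_of_nonpos (mul_nonpos_of_nonpos_of_nonneg h1 hd)
      (sub_nonpos.2 h.le)
end

section
/- Let f₀ : ℝ → ℝ be a nonnegative, integrable C² function with integrable derivative f₀', with f₀(p) → 0 as |p| → ∞, and suppose f₀' has finitely many zeros, more than one, and every zero p of f₀' is nondegenerate (f₀''(p) ≠ 0). Then f₀ is structurally unstable under dynamically accessible perturbations: for every δ > 0 there exists a strictly increasing C¹ diffeomorphism p̂ : ℝ → ℝ such that the rearranged equilibrium g = f₀ ∘ p̂ satisfies ∫_ℝ|g − f₀| + ∫_ℝ|g' − f₀'| < δ, and there exist k > 0 and z ∈ ℂ with Im z > 0 such that ε_{g'}(k,z) = 0. -/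
open MeasureTheory Filter

theorem exists_eq_zero_and_deriv_pos {f : ℝ → ℝ} (hf : Continuous f)
    (hfin : {p : ℝ | f p = 0}.Finite) (hmany : 1 < hfin.toFinset.card)
    (hnondeg : ∀ p, f p = 0 → deriv f p ≠ 0) : ∃ p, f p = 0 ∧ 0 < deriv f p := by
  by_contra! hcon
  have hneg : ∀ p, f p = 0 → deriv f p < 0 := fun p hp => lt_of_le_of_ne (hcon p hp) (hnondeg p hp)
  obtain ⟨a, ha, a', ha', haa⟩ : ∃ a, f a = 0 ∧ ∃ a', f a' = 0 ∧ a < a' := by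
    obtain ⟨u, hu, v, hv, huv⟩ := Finset.one_lt_card.1 hmany
    simp only [Set.Finite.mem_toFinset, Set.mem_ofPred_eq] at hu hv
    rcases lt_or_gt_of_ne huv with h | h
    exacts [⟨u, hu, v, hv, h⟩, ⟨v, hv, u, hu, h⟩]
  obtain ⟨b, ⟨hab, hb⟩, hmin⟩ : ∃ b, (a < b ∧ f b = 0) ∧ ∀ c, a < c → f c = 0 → b ≤ c := by
    have hS : (hfin.toFinset.filter (a < ·)).Nonempty := ⟨a', by simp [ha', haa]⟩
    have hmem := Finset.min'_mem _ hS
    simp only [Finset.mem_filter, Set.Finite.mem_toFinset, Set.mem_ofPred_eq] at hmem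
    exact ⟨_, hmem.symm, fun c hc hc0 => Finset.min'_le _ c (by simp [hc, hc0])⟩
  have h1 := (eventually_nhdsWithin_sign_eq_of_deriv_neg (hneg a ha) ha)
  have h2 := (eventually_nhdsWithin_sign_eq_of_deriv_neg (hneg b hb) hb)
  obtain ⟨p, hp, hap, hpm⟩ := ((h1.filter_mono nhdsWithin_le_nhds).and
    (Ioo_mem_nhdsGT (show a < (a + b) / 2 by linarith))).exists
  obtain ⟨q, hq, hqm, hqb⟩ := ((h2.filter_mono nhdsWithin_le_nhds).and
    (Ioo_mem_nhdsLT (show (a + b) / 2 < b by linarith))).exists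
  rw [sign_neg (by linarith : a - p < 0), sign_eq_neg_one_iff] at hp
  rw [sign_pos (by linarith : 0 < b - q), sign_eq_one_iff] at hq
  obtain ⟨c, hc, hc0⟩ := intermediate_value_Icc (by linarith : p ≤ q) hf.continuousOn
    ⟨hp.le, hq.le⟩
  linarith [hmin c (by linarith [hc.1]) hc0, hc.2]

theorem tendsto_poisson_integral {G : ℝ → ℝ} (hG : Integrable G) {x : ℝ} (hx : ContinuousAt G x) :
    Tendsto (fun y : ℝ => ∫ p, G p * (y / ((p - x) ^ 2 + y ^ 2))) (nhdsWithin 0 (Set.Ioi 0))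
      (nhds (Real.pi * G x)) := by
  have key := tendsto_integral_comp_smul_smul_of_integrable' (μ := volume) (F := ℝ)
    (φ := fun t => Real.pi⁻¹ * (1 + t ^ 2)⁻¹) (fun t => by positivity)
    (by rw [integral_const_mul, integral_univ_inv_one_add_sq]; field_simp) ?_ hG hx
  · have := (key.comp tendsto_inv_nhdsGT_zero).const_mul Real.pi
    refine this.congr' ?_
    filter_upwards [self_mem_nhdsWithin] with y hy
    have hy : 0 < y := hy
    simp only [Function.comp]
    rw [← integral_const_mul]
    congr 1; ext p
    simp only [Module.finrank_self, smul_eq_mul]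
    have : 0 < (p - x) ^ 2 + y ^ 2 := by positivity
    have h3 : 1 + (y⁻¹ * (x - p)) ^ 2 = ((p - x) ^ 2 + y ^ 2) / y ^ 2 := by field_simp; ring
    rw [h3]
    field_simp
  · simp only [Module.finrank_self, pow_one]
    have hlim : Tendsto (fun t : ℝ => Real.pi⁻¹ * ‖t‖⁻¹) (Bornology.cobounded ℝ) (nhds 0) := by
      simpa using (tendsto_inv_atTop_zero.comp (tendsto_norm_cobounded_atTop (E := ℝ))).const_mul Real.pi⁻¹
    refine squeeze_zero (fun t => by positivity) (fun t => ?_) hlim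
    rw [mul_left_comm]
    refine mul_le_mul_of_nonneg_left ?_ (by positivity)
    rcases eq_or_ne t 0 with rfl | ht
    · simp
    have : 0 < ‖t‖ := norm_pos_iff.2 ht
    rw [← div_eq_mul_inv, div_le_iff₀ (by positivity), ← sq_abs, ← Real.norm_eq_abs]
    field_simp
    nlinarith

theorem abs_poisson_kernel_le {y : ℝ} (hy : 0 < y) (u : ℝ) : |y / (u ^ 2 + y ^ 2)| ≤ 1 / y := by
  rw [abs_of_nonneg (by positivity), div_le_div_iff₀ (by positivity) hy]
  nlinarith [sq_nonneg u]

theorem abs_conj_poisson_kernel_le {y : ℝ} (hy : 0 < y) (u : ℝ) :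
    |u / (u ^ 2 + y ^ 2)| ≤ 1 / y := by
  rw [abs_div, abs_of_pos (by positivity : 0 < u ^ 2 + y ^ 2),
    div_le_div_iff₀ (by positivity) hy, ← sq_abs u]
  nlinarith [sq_nonneg (|u| - y), abs_nonneg u]

theorem integrable_mul_poisson_kernel {G : ℝ → ℝ} (hG : Integrable G) (x : ℝ) {y : ℝ}
    (hy : 0 < y) : Integrable fun p => G p * (y / ((p - x) ^ 2 + y ^ 2)) := by
  refine hG.mul_bdd (c := 1 / y) ?_ (.of_forall fun p => abs_poisson_kernel_le hy _)
  exact (Continuous.div (by fun_prop) (by fun_prop) fun p => by positivity).aestronglyMeasurable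

theorem integrable_mul_conj_poisson_kernel {G : ℝ → ℝ} (hG : Integrable G) (x : ℝ) {y : ℝ}
    (hy : 0 < y) : Integrable fun p => G p * ((p - x) / ((p - x) ^ 2 + y ^ 2)) := by
  refine hG.mul_bdd (c := 1 / y) ?_ (.of_forall fun p => abs_conj_poisson_kernel_le hy _)
  exact (Continuous.div (by fun_prop) (by fun_prop) fun p => by positivity).aestronglyMeasurable

theorem continuous_poisson_integral {G : ℝ → ℝ} (hG : Integrable G) {y : ℝ} (hy : 0 < y) :
    Continuous fun x => ∫ p, G p * (y / ((p - x) ^ 2 + y ^ 2)) := by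
  refine continuous_of_dominated (bound := fun p => |G p| * (1 / y))
    (fun x => (integrable_mul_poisson_kernel hG x hy).aestronglyMeasurable)
    (fun x => .of_forall fun p => ?_) (hG.abs.mul_const _) (.of_forall fun p => ?_)
  · rw [Real.norm_eq_abs, abs_mul]
    exact mul_le_mul_of_nonneg_left (abs_poisson_kernel_le hy _) (abs_nonneg _)
  · exact continuous_const.mul (Continuous.div (by fun_prop) (by fun_prop) fun x => by positivity)

theorem integral_cauchy_kernel {G : ℝ → ℝ} (hG : Integrable G) (x : ℝ) {y : ℝ} (hy : 0 < y) :
    ∫ p : ℝ, (G p : ℂ) / ((⟨x, y⟩ : ℂ) - p) =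
      -((∫ p, G p * ((p - x) / ((p - x) ^ 2 + y ^ 2)) : ℝ) : ℂ) -
        ((∫ p, G p * (y / ((p - x) ^ 2 + y ^ 2)) : ℝ) : ℂ) * Complex.I := by
  rw [← integral_complex_ofReal, ← integral_complex_ofReal, ← integral_mul_const,
    ← neg_add', ← integral_add (integrable_mul_conj_poisson_kernel hG x hy).ofReal
      ((integrable_mul_poisson_kernel hG x hy).ofReal.mul_const _), ← integral_neg]
  congr 1; ext p
  have hD : (((p - x) ^ 2 + y ^ 2 : ℝ) : ℂ) ≠ 0 := by
    exact_mod_cast (by positivity : (p - x) ^ 2 + y ^ 2 ≠ 0)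
  have hz : (⟨x, y⟩ : ℂ) = x + y * Complex.I := by apply Complex.ext <;> simp
  have hz0 : (x + y * Complex.I - p : ℂ) ≠ 0 := by
    intro h
    have := congrArg Complex.im h
    simp at this
    exact hy.ne' this
  push_cast at hD ⊢
  rw [hz]
  field_simp
  linear_combination ((G p : ℂ) * y ^ 2) * Complex.I_sq

theorem exists_eps_eq_zero {G : ℝ → ℝ} (hG : Integrable G) {x y : ℝ} (hy : 0 < y)
    (him : ∫ p, G p * (y / ((p - x) ^ 2 + y ^ 2)) = 0)
    (hre : 0 < ∫ p, G p * ((p - x) / ((p - x) ^ 2 + y ^ 2))) :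
    ∃ k : ℝ, 0 < k ∧ ∃ z : ℂ, 0 < z.im ∧ eps G k z = 0 := by
  refine ⟨√(∫ p, G p * ((p - x) / ((p - x) ^ 2 + y ^ 2))), Real.sqrt_pos.2 hre, ⟨x, y⟩, hy, ?_⟩
  rw [eps, integral_cauchy_kernel hG x hy, him, ← Complex.ofReal_pow, Real.sq_sqrt hre.le]
  have : ((∫ p, G p * ((p - x) / ((p - x) ^ 2 + y ^ 2)) : ℝ) : ℂ) ≠ 0 :=
    Complex.ofReal_ne_zero.2 hre.ne'
  generalize ((∫ p, G p * ((p - x) / ((p - x) ^ 2 + y ^ 2)) : ℝ) : ℂ) = A at *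
  simp [this]

theorem setIntegral_conj_poisson_kernel (x a y : ℝ) :
    ∫ p in Set.Icc (x - a) (x + a), (p - x) / ((p - x) ^ 2 + y ^ 2) = 0 := by
  rcases lt_or_ge a 0 with ha | ha
  · rw [Set.Icc_eq_empty (by linarith)]; simp
  rw [integral_Icc_eq_integral_Ioc, ← intervalIntegral.integral_of_le (by linarith),
    intervalIntegral.integral_comp_sub_right (fun u => u / (u ^ 2 + y ^ 2)) x]
  have h := intervalIntegral.integral_comp_neg (fun u : ℝ => u / (u ^ 2 + y ^ 2)) (a := -a) (b := a)
  simp only [neg_neg, neg_sq, neg_div, intervalIntegral.integral_neg] at h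
  rw [show x - a - x = -a by ring, show x + a - x = a by ring]
  linarith

theorem conj_poisson_integral_pos {G : ℝ → ℝ} (hG : Integrable G) {p₀ a m R L x y : ℝ}
    (ha : 0 < a) (hm : 0 < m) (haR : 2 * a ≤ R)
    (hmono : ∀ q p, p₀ - 2 * a ≤ q → q ≤ p → p ≤ p₀ + 2 * a → m * (p - q) ≤ G p - G q)
    (hsign : ∀ p, |p - p₀| ≤ R → 0 ≤ G p * (p - p₀))
    (hfar : ∫ p in {p | R < |p - p₀|}, |G p| ≤ L) (hL : 2 / R * L < m * a / 4)
    (hx : x ∈ Set.Icc (p₀ - a) (p₀ + a)) (hy : 0 < y) (hya : y ≤ a / 2) :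
    0 < ∫ p, G p * ((p - x) / ((p - x) ^ 2 + y ^ 2)) := by
  have hR : 0 < R := by linarith
  set near := Set.Icc (x - a) (x + a)
  set half := Set.Icc (x + a / 2) (x + a) with hhalf
  set far := {p : ℝ | R < |p - p₀|} with hfardef
  have hfarm : MeasurableSet far := measurableSet_lt measurable_const (by fun_prop)
  have hcont : Continuous fun p : ℝ => (p - x) / ((p - x) ^ 2 + y ^ 2) :=
    Continuous.div (by fun_prop) (by fun_prop) fun p => by positivity
  have hi1 := integrable_mul_conj_poisson_kernel hG x hy
  have hi2 : Integrable (near.indicator fun p => G x * ((p - x) / ((p - x) ^ 2 + y ^ 2))) :=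
    (integrable_indicator_iff measurableSet_Icc).2
      (continuous_const.mul hcont).continuousOn.integrableOn_Icc
  have hi3 : Integrable (half.indicator fun _ : ℝ => m / 2) :=
    (integrable_indicator_iff measurableSet_Icc).2 continuousOn_const.integrableOn_Icc
  have hi4 : Integrable (far.indicator fun p => 2 / R * |G p|) :=
    (hG.abs.const_mul _).indicator hfarm
  have hle := integral_mono (hi3.sub hi4) (hi1.sub hi2) (fun p => ?_)
  · rw [integral_sub' hi3 hi4, integral_sub' hi1 hi2, integral_indicator measurableSet_Icc,
      integral_indicator measurableSet_Icc, integral_indicator hfarm, integral_const_mul,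
      integral_const_mul, setIntegral_conj_poisson_kernel, setIntegral_const] at hle
    have hv : volume.real half = a / 2 := by
      rw [hhalf, Real.volume_real_Icc_of_le (by linarith)]; ring
    rw [hv, smul_eq_mul] at hle
    have := mul_le_mul_of_nonneg_left hfar (by positivity : 0 ≤ 2 / R)
    linarith
  have hD : 0 < (p - x) ^ 2 + y ^ 2 := by positivity
  obtain ⟨hx1, hx2⟩ := hx
  simp only [Pi.sub_apply]
  by_cases hn : p ∈ near
  · have hf : p ∉ far := by
      simp only [hfardef, Set.mem_ofPred_eq, not_lt, abs_le]
      constructor <;> linarith [hn.1, hn.2]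
    rw [Set.indicator_of_mem hn, Set.indicator_of_notMem hf, sub_zero, ← sub_mul, ← mul_div_assoc,
      le_div_iff₀ hD]
    have hlow : m * (p - x) ^ 2 ≤ (G p - G x) * (p - x) := by
      rcases le_total x p with h | h
      · nlinarith [hmono x p (by linarith) h (by linarith [hn.2])]
      · nlinarith [hmono p x (by linarith [hn.1]) h (by linarith)]
    by_cases hh : p ∈ half
    · rw [Set.indicator_of_mem hh]
      have : y ^ 2 ≤ (p - x) ^ 2 := by nlinarith [hh.1]
      nlinarith
    · rw [Set.indicator_of_notMem hh, zero_mul]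
      exact le_trans (by positivity) hlow
  · have hh : p ∉ half := fun h => hn ⟨by linarith [h.1], h.2⟩
    rw [Set.indicator_of_notMem hn, Set.indicator_of_notMem hh, sub_zero, zero_sub]
    have hn' : p < x - a ∨ x + a < p := by
      by_contra! h; exact hn h
    by_cases hf : p ∈ far
    · rw [Set.indicator_of_mem hf]
      have hf' : R < |p - p₀| := hf
      have hpx : R / 2 ≤ |p - x| := by
        rcases lt_abs.1 hf' with h | h
        · exact le_trans (by linarith) (le_abs_self _)
        · exact le_trans (by linarith) (neg_le_abs _)
      have hk : |(p - x) / ((p - x) ^ 2 + y ^ 2)| ≤ 2 / R := by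
        rw [abs_div, abs_of_pos hD, div_le_div_iff₀ hD hR, ← sq_abs (p - x)]
        nlinarith [sq_nonneg y]
      have := neg_abs_le (G p * ((p - x) / ((p - x) ^ 2 + y ^ 2)))
      rw [abs_mul] at this
      nlinarith [mul_le_mul_of_nonneg_left hk (abs_nonneg (G p))]
    · rw [Set.indicator_of_notMem hf, neg_zero, ← mul_div_assoc]
      have hs := hsign p (not_lt.1 hf)
      refine div_nonneg ?_ hD.le
      rcases hn' with h | h
      · have : G p ≤ 0 := by
          by_contra! h'
          nlinarith
        nlinarith
      · have : 0 ≤ G p := by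
          by_contra! h'
          nlinarith
        nlinarith

theorem exists_eps_eq_zero_of_steep_min {G : ℝ → ℝ} (hG : Integrable G) (hGc : Continuous G)
    {p₀ a m R L : ℝ} (ha : 0 < a) (hm : 0 < m) (haR : 2 * a ≤ R) (h0 : G p₀ = 0)
    (hmono : ∀ q p, p₀ - 2 * a ≤ q → q ≤ p → p ≤ p₀ + 2 * a → m * (p - q) ≤ G p - G q)
    (hsign : ∀ p, |p - p₀| ≤ R → 0 ≤ G p * (p - p₀))
    (hfar : ∫ p in {p | R < |p - p₀|}, |G p| ≤ L) (hL : 2 / R * L < m * a / 4) :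
    ∃ k : ℝ, 0 < k ∧ ∃ z : ℂ, 0 < z.im ∧ eps G k z = 0 := by
  have hr : 0 < G (p₀ + a) := by
    nlinarith [hmono p₀ (p₀ + a) (by linarith) (by linarith) (by linarith)]
  have hl : G (p₀ - a) < 0 := by
    nlinarith [hmono (p₀ - a) p₀ (by linarith) (by linarith) (by linarith)]
  have er := (tendsto_poisson_integral hG hGc.continuousAt).eventually_const_lt
    (mul_pos Real.pi_pos hr)
  have el := (tendsto_poisson_integral hG hGc.continuousAt).eventually_lt_const
    (mul_neg_of_pos_of_neg Real.pi_pos hl)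
  obtain ⟨y, ⟨hyr, hyl⟩, hy, hya⟩ := ((er.and el).and
    (Ioo_mem_nhdsGT (show 0 < a / 2 by linarith))).exists
  obtain ⟨x, hx, hx0⟩ := intermediate_value_Icc (by linarith : p₀ - a ≤ p₀ + a)
    (continuous_poisson_integral hG hy).continuousOn ⟨hyl.le, hyr.le⟩
  exact exists_eps_eq_zero hG hy hx0
    (conj_poisson_integral_pos hG ha hm haR hmono hsign hfar hL hx hy hya.le)

/-- The trapezoidal cutoff: `1` on `[-1, 1]`, `0` outside `[-2, 2]`, affine in between. -/
noncomputable def trapezoid (u : ℝ) : ℝ := max 0 (min 1 (2 - |u|))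

/-- The primitive of `trapezoid`: the identity on `[-1, 1]`, constant on each side of `[-2, 2]`. -/
noncomputable def ramp (u : ℝ) : ℝ := ∫ t in (0 : ℝ)..u, trapezoid t

theorem continuous_trapezoid : Continuous trapezoid := by
  unfold trapezoid; fun_prop

theorem trapezoid_nonneg (u : ℝ) : 0 ≤ trapezoid u := le_max_left _ _

theorem trapezoid_le_one (u : ℝ) : trapezoid u ≤ 1 := max_le zero_le_one (min_le_left _ _)

theorem trapezoid_of_abs_le {u : ℝ} (hu : |u| ≤ 1) : trapezoid u = 1 := by
  rw [trapezoid, min_eq_left (by linarith), max_eq_right zero_le_one]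

theorem trapezoid_of_le_abs {u : ℝ} (hu : 2 ≤ |u|) : trapezoid u = 0 :=
  max_eq_left ((min_le_right _ _).trans (by linarith))

theorem hasDerivAt_ramp (u : ℝ) : HasDerivAt ramp (trapezoid u) u :=
  continuous_trapezoid.integral_hasStrictDerivAt 0 u |>.hasDerivAt

theorem ramp_of_abs_le {u : ℝ} (hu : |u| ≤ 1) : ramp u = u := by
  have : Set.EqOn trapezoid (fun _ => 1) (Set.uIcc 0 u) := fun t ht =>
    trapezoid_of_abs_le <| by
      have := Set.abs_sub_left_of_mem_uIcc ht
      simp only [sub_zero] at this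
      exact this.trans hu
  rw [ramp, intervalIntegral.integral_congr this]
  simp

theorem ramp_eq_of_two_le_abs {u v : ℝ} (h : ∀ t ∈ Set.uIcc u v, 2 ≤ |t|) : ramp u = ramp v := by
  have hi : ∀ a b, IntervalIntegrable trapezoid volume a b := fun a b =>
    continuous_trapezoid.intervalIntegrable a b
  have : ∫ t in u..v, trapezoid t = 0 := by
    rw [intervalIntegral.integral_congr (g := fun _ => 0) fun t ht => trapezoid_of_le_abs (h t ht)]
    simp
  rw [ramp, ramp, ← intervalIntegral.integral_add_adjacent_intervals (hi 0 u) (hi u v), this,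
    add_zero]

theorem ramp_eq_of_two_le {u v : ℝ} (hu : 2 ≤ u) (hv : 2 ≤ v) : ramp u = ramp v :=
  ramp_eq_of_two_le_abs fun _ ht => (le_min hu hv).trans (ht.1.trans (le_abs_self _))

theorem ramp_eq_of_le_neg_two {u v : ℝ} (hu : u ≤ -2) (hv : v ≤ -2) : ramp u = ramp v :=
  ramp_eq_of_two_le_abs fun t ht => by
    have h : t ≤ -2 := ht.2.trans (max_le hu hv)
    exact le_trans (by linarith) (neg_le_abs t)

/-- A diffeomorphism of the line that stretches `[p₀ - b, p₀ + b]` affinely, with slope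
`(1 + s / b) / 2`, and is the identity outside `[p₀ - 2 * s, p₀ + 2 * s]`. -/
noncomputable def stretch (p₀ s b p : ℝ) : ℝ :=
  p + s / 2 * (ramp ((p - p₀) / b) - ramp ((p - p₀) / s))

/-- The derivative of `stretch`. -/
noncomputable def stretchDeriv (p₀ s b p : ℝ) : ℝ :=
  1 + s / 2 * (trapezoid ((p - p₀) / b) / b - trapezoid ((p - p₀) / s) / s)

theorem hasDerivAt_stretch (p₀ s b p : ℝ) :
    HasDerivAt (stretch p₀ s b) (stretchDeriv p₀ s b p) p := by
  have h : ∀ c : ℝ, HasDerivAt (fun p => ramp ((p - p₀) / c)) (trapezoid ((p - p₀) / c) / c) p :=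
    fun c => by
      have := (hasDerivAt_ramp ((p - p₀) / c)).comp p (((hasDerivAt_id p).sub_const p₀).div_const c)
      simpa [Function.comp_def, div_eq_mul_inv] using this
  exact (hasDerivAt_id p).add (((h b).sub (h s)).const_mul (s / 2))

theorem continuous_stretchDeriv (p₀ s b : ℝ) : Continuous (stretchDeriv p₀ s b) := by
  have := continuous_trapezoid
  unfold stretchDeriv
  fun_prop

theorem deriv_stretch (p₀ s b : ℝ) : deriv (stretch p₀ s b) = stretchDeriv p₀ s b :=
  funext fun p => (hasDerivAt_stretch p₀ s b p).deriv

theorem contDiff_stretch (p₀ s b : ℝ) : ContDiff ℝ 1 (stretch p₀ s b) :=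
  contDiff_one_iff_deriv.2 ⟨fun p => (hasDerivAt_stretch p₀ s b p).differentiableAt, by
    rw [deriv_stretch]; exact continuous_stretchDeriv p₀ s b⟩

section

variable {p₀ s b : ℝ}

theorem stretchDeriv_pos (hb : 0 < b) (hs : 0 < s) (p : ℝ) : 0 < stretchDeriv p₀ s b p := by
  have h1 : 0 ≤ s / 2 * (trapezoid ((p - p₀) / b) / b) := by
    have := trapezoid_nonneg ((p - p₀) / b)
    positivity
  have h2 : s / 2 * (trapezoid ((p - p₀) / s) / s) ≤ 1 / 2 := by
    have := trapezoid_le_one ((p - p₀) / s)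
    field_simp
    linarith
  rw [stretchDeriv, mul_sub]
  linarith

theorem strictMono_stretch (hb : 0 < b) (hs : 0 < s) : StrictMono (stretch p₀ s b) :=
  strictMono_of_deriv_pos fun p => by rw [deriv_stretch]; exact stretchDeriv_pos hb hs p

theorem stretch_of_abs_le (hb : 0 < b) (hbs : b ≤ s) {p : ℝ} (hp : |p - p₀| ≤ b) :
    stretch p₀ s b p = p₀ + (1 + s / b) / 2 * (p - p₀) := by
  have hs : 0 < s := hb.trans_le hbs
  rw [stretch, ramp_of_abs_le, ramp_of_abs_le]
  · field_simp; ring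
  · rw [abs_div, abs_of_pos hs, div_le_one hs]; exact hp.trans hbs
  · rwa [abs_div, abs_of_pos hb, div_le_one hb]

theorem stretchDeriv_of_abs_le (hb : 0 < b) (hbs : b ≤ s) {p : ℝ} (hp : |p - p₀| ≤ b) :
    stretchDeriv p₀ s b p = (1 + s / b) / 2 := by
  have hs : 0 < s := hb.trans_le hbs
  rw [stretchDeriv, trapezoid_of_abs_le, trapezoid_of_abs_le]
  · field_simp; ring
  · rw [abs_div, abs_of_pos hs, div_le_one hs]; exact hp.trans hbs
  · rwa [abs_div, abs_of_pos hb, div_le_one hb]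

theorem stretch_of_le_abs (hb : 0 < b) (hbs : b ≤ s) {p : ℝ} (hp : 2 * s ≤ |p - p₀|) :
    stretch p₀ s b p = p := by
  have hs : 0 < s := hb.trans_le hbs
  suffices h : ramp ((p - p₀) / b) = ramp ((p - p₀) / s) by rw [stretch, h]; ring
  rcases le_abs.1 hp with h | h
  · exact ramp_eq_of_two_le ((le_div_iff₀ hb).2 (by linarith)) ((le_div_iff₀ hs).2 (by linarith))
  · exact ramp_eq_of_le_neg_two ((div_le_iff₀ hb).2 (by linarith))
      ((div_le_iff₀ hs).2 (by linarith))

theorem stretchDeriv_of_le_abs (hb : 0 < b) (hbs : b ≤ s) {p : ℝ} (hp : 2 * s ≤ |p - p₀|) :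
    stretchDeriv p₀ s b p = 1 := by
  have hs : 0 < s := hb.trans_le hbs
  rw [stretchDeriv, trapezoid_of_le_abs, trapezoid_of_le_abs]
  · ring
  · rw [abs_div, abs_of_pos hs, le_div_iff₀ hs]; exact hp
  · rw [abs_div, abs_of_pos hb, le_div_iff₀ hb]; linarith

theorem bijective_stretch (hb : 0 < b) (hbs : b ≤ s) : Function.Bijective (stretch p₀ s b) := by
  have hs : 0 < s := hb.trans_le hbs
  refine ⟨(strictMono_stretch hb hs).injective,
    (contDiff_stretch p₀ s b).continuous.surjective (tendsto_id.congr' ?_) (tendsto_id.congr' ?_)⟩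
  · filter_upwards [eventually_ge_atTop (p₀ + 2 * s)] with p hp
    exact (stretch_of_le_abs hb hbs (le_abs.2 (.inl (by dsimp; linarith)))).symm
  · filter_upwards [eventually_le_atBot (p₀ - 2 * s)] with p hp
    exact (stretch_of_le_abs hb hbs (le_abs.2 (.inr (by dsimp; linarith)))).symm

theorem stretch_center (hb : 0 < b) (hbs : b ≤ s) : stretch p₀ s b p₀ = p₀ := by
  rw [stretch_of_abs_le hb hbs (by simpa using hb.le)]; ring

theorem stretch_left (hb : 0 < b) (hbs : b ≤ s) :
    stretch p₀ s b (p₀ - 2 * s) = p₀ - 2 * s :=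
  stretch_of_le_abs hb hbs (le_abs.2 (.inr (by linarith)))

theorem stretch_right (hb : 0 < b) (hbs : b ≤ s) :
    stretch p₀ s b (p₀ + 2 * s) = p₀ + 2 * s :=
  stretch_of_le_abs hb hbs (le_abs.2 (.inl (by linarith)))

theorem stretch_mem_Icc (hb : 0 < b) (hbs : b ≤ s) {p : ℝ}
    (hp : p ∈ Set.Icc (p₀ - 2 * s) (p₀ + 2 * s)) :
    stretch p₀ s b p ∈ Set.Icc (p₀ - 2 * s) (p₀ + 2 * s) := by
  have hmono := (strictMono_stretch (p₀ := p₀) hb (hb.trans_le hbs)).monotone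
  have h1 := hmono hp.1
  have h2 := hmono hp.2
  rw [stretch_left hb hbs] at h1
  rw [stretch_right hb hbs] at h2
  exact ⟨h1, h2⟩

theorem setIntegral_stretchDeriv (hb : 0 < b) (hbs : b ≤ s) :
    ∫ p in Set.Icc (p₀ - 2 * s) (p₀ + 2 * s), stretchDeriv p₀ s b p = 4 * s := by
  rw [integral_Icc_eq_integral_Ioc, ← intervalIntegral.integral_of_le (by linarith),
    intervalIntegral.integral_eq_sub_of_hasDerivAt (fun p _ => hasDerivAt_stretch p₀ s b p)
      ((continuous_stretchDeriv p₀ s b).intervalIntegrable _ _),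
    stretch_left hb hbs, stretch_right hb hbs]
  ring

end

theorem two_mul_le_abs_of_notMem_Icc {p₀ s p : ℝ}
    (hp : p ∉ Set.Icc (p₀ - 2 * s) (p₀ + 2 * s)) : 2 * s ≤ |p - p₀| := by
  by_contra! h
  rw [abs_lt] at h
  exact hp ⟨by linarith, by linarith⟩

section

variable {f : ℝ → ℝ} {p₀ s b B : ℝ}

theorem deriv_comp_stretch (hf : Differentiable ℝ f) (p₀ s b p : ℝ) :
    deriv (f ∘ stretch p₀ s b) p = deriv f (stretch p₀ s b p) * stretchDeriv p₀ s b p :=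
  ((hf _).hasDerivAt.comp p (hasDerivAt_stretch p₀ s b p)).deriv

theorem deriv_comp_stretch_of_le_abs (hf : Differentiable ℝ f) (hb : 0 < b) (hbs : b ≤ s) {p : ℝ}
    (hp : 2 * s ≤ |p - p₀|) : deriv (f ∘ stretch p₀ s b) p = deriv f p := by
  rw [deriv_comp_stretch hf, stretch_of_le_abs hb hbs hp, stretchDeriv_of_le_abs hb hbs hp, mul_one]

theorem continuous_deriv_comp_stretch (hf : ContDiff ℝ 1 f) (p₀ s b : ℝ) :
    Continuous (deriv (f ∘ stretch p₀ s b)) :=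
  (hf.comp (contDiff_stretch p₀ s b)).continuous_deriv le_rfl

theorem integrable_deriv_comp_stretch (hf : ContDiff ℝ 1 f) (hf' : Integrable (deriv f))
    (hb : 0 < b) (hbs : b ≤ s) : Integrable (deriv (f ∘ stretch p₀ s b)) := by
  have hd : Integrable fun p => deriv (f ∘ stretch p₀ s b) p - deriv f p := by
    refine ((continuous_deriv_comp_stretch hf p₀ s b).sub
      (hf.continuous_deriv le_rfl)).integrable_of_hasCompactSupport ?_
    refine HasCompactSupport.intro (isCompact_Icc (a := p₀ - 2 * s) (b := p₀ + 2 * s))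
      fun p hp => ?_
    rw [Pi.sub_apply, deriv_comp_stretch_of_le_abs (hf.differentiable one_ne_zero) hb hbs
      (two_mul_le_abs_of_notMem_Icc hp), sub_self]
  exact (hd.add hf').congr (.of_forall fun p => sub_add_cancel _ _)

theorem integral_abs_comp_stretch_sub_le (hf : Continuous f) (hb : 0 < b) (hbs : b ≤ s)
    (hB : ∀ p ∈ Set.Icc (p₀ - 2 * s) (p₀ + 2 * s), |f p| ≤ B) :
    ∫ p, |f (stretch p₀ s b p) - f p| ≤ 8 * s * B := by
  have hs : 0 < s := hb.trans_le hbs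
  rw [← setIntegral_eq_integral_of_forall_compl_eq_zero
    (s := Set.Icc (p₀ - 2 * s) (p₀ + 2 * s)) fun p hp => by
      rw [stretch_of_le_abs hb hbs (two_mul_le_abs_of_notMem_Icc hp), sub_self, abs_zero]]
  have hc := (contDiff_stretch p₀ s b).continuous
  calc ∫ p in Set.Icc (p₀ - 2 * s) (p₀ + 2 * s), |f (stretch p₀ s b p) - f p|
      ≤ ∫ _ in Set.Icc (p₀ - 2 * s) (p₀ + 2 * s), 2 * B := by
        refine setIntegral_mono_on (Continuous.integrableOn_Icc (by fun_prop))
          continuous_const.integrableOn_Icc measurableSet_Icc fun p hp => ?_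
        linarith [abs_sub (f (stretch p₀ s b p)) (f p), hB p hp, hB _ (stretch_mem_Icc hb hbs hp)]
    _ = 8 * s * B := by
        rw [setIntegral_const, Real.volume_real_Icc_of_le (by linarith), smul_eq_mul]
        ring

theorem integral_abs_deriv_comp_stretch_sub_le (hf : ContDiff ℝ 1 f) (hb : 0 < b) (hbs : b ≤ s)
    (hB : ∀ p ∈ Set.Icc (p₀ - 2 * s) (p₀ + 2 * s), |deriv f p| ≤ B) :
    ∫ p, |deriv (f ∘ stretch p₀ s b) p - deriv f p| ≤ 8 * s * B := by
  have hs : 0 < s := hb.trans_le hbs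
  have hdf := hf.differentiable one_ne_zero
  rw [← setIntegral_eq_integral_of_forall_compl_eq_zero
    (s := Set.Icc (p₀ - 2 * s) (p₀ + 2 * s)) fun p hp => by
      rw [deriv_comp_stretch_of_le_abs hdf hb hbs (two_mul_le_abs_of_notMem_Icc hp), sub_self,
        abs_zero]]
  have hc := continuous_deriv_comp_stretch hf p₀ s b
  have hc' := hf.continuous_deriv le_rfl
  have hsd := continuous_stretchDeriv p₀ s b
  calc ∫ p in Set.Icc (p₀ - 2 * s) (p₀ + 2 * s), |deriv (f ∘ stretch p₀ s b) p - deriv f p|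
      ≤ ∫ p in Set.Icc (p₀ - 2 * s) (p₀ + 2 * s), (B * stretchDeriv p₀ s b p + B) := by
        refine setIntegral_mono_on (Continuous.integrableOn_Icc (by fun_prop))
          (Continuous.integrableOn_Icc (by fun_prop)) measurableSet_Icc fun p hp => ?_
        have hpos := stretchDeriv_pos (p₀ := p₀) hb hs p
        have h := abs_sub (deriv (f ∘ stretch p₀ s b) p) (deriv f p)
        rw [deriv_comp_stretch hdf, abs_mul, abs_of_pos hpos] at h
        rw [deriv_comp_stretch hdf]
        linarith [hB p hp, mul_le_mul_of_nonneg_right (hB _ (stretch_mem_Icc hb hbs hp)) hpos.le]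
    _ = 8 * s * B := by
        rw [integral_add (Continuous.integrableOn_Icc (by fun_prop))
          continuous_const.integrableOn_Icc, integral_const_mul, setIntegral_stretchDeriv hb hbs,
          setIntegral_const, Real.volume_real_Icc_of_le (by linarith), smul_eq_mul]
        ring

theorem exists_eps_deriv_comp_stretch_eq_zero {c : ℝ} (hf : ContDiff ℝ 1 f)
    (hf' : Integrable (deriv f)) (h0 : deriv f p₀ = 0) (hc : 0 < c) (hs : 0 < s)
    (hconv : ∀ q ∈ Set.Icc (p₀ - 2 * s) (p₀ + 2 * s), ∀ p ∈ Set.Icc (p₀ - 2 * s) (p₀ + 2 * s),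
      q ≤ p → c * (p - q) ≤ deriv f p - deriv f q) :
    ∃ b, 0 < b ∧ b ≤ s ∧ ∃ k : ℝ, 0 < k ∧ ∃ z : ℂ, 0 < z.im ∧
      eps (deriv (f ∘ stretch p₀ s b)) k z = 0 := by
  set L := ∫ p, |deriv f p|
  have hL0 : 0 ≤ L := integral_nonneg fun p => abs_nonneg _
  have hdf := hf.differentiable one_ne_zero
  obtain ⟨b, hb, hbs, hbL⟩ : ∃ b, 0 < b ∧ b ≤ s ∧ b * (32 * (L + 1)) ≤ c * s ^ 3 := by
    refine ⟨min s (c * s ^ 3 / (32 * (L + 1))), by positivity, min_le_left _ _, ?_⟩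
    rw [← le_div_iff₀ (by positivity)]
    exact min_le_right _ _
  have hp₀ : p₀ ∈ Set.Icc (p₀ - 2 * s) (p₀ + 2 * s) := ⟨by linarith, by linarith⟩
  refine ⟨b, hb, hbs, exists_eps_eq_zero_of_steep_min (p₀ := p₀) (a := b / 2)
    (m := c * (s / (2 * b)) ^ 2) (R := 2 * s) (L := L)
    (integrable_deriv_comp_stretch hf hf' hb hbs) (continuous_deriv_comp_stretch hf p₀ s b)
    (by positivity) (by positivity) (by linarith) ?_ ?_ ?_ ?_ ?_⟩
  · rw [deriv_comp_stretch hdf, stretch_center hb hbs, h0, zero_mul]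
  · intro q p hq hqp hp
    have hin : ∀ t, p₀ - 2 * (b / 2) ≤ t → t ≤ p₀ + 2 * (b / 2) → |t - p₀| ≤ b := fun t h1 h2 =>
      abs_le.2 ⟨by linarith, by linarith⟩
    have hq' := hin q hq (by linarith)
    have hp' := hin p (by linarith) hp
    have hmem : ∀ t, |t - p₀| ≤ b →
        stretch p₀ s b t ∈ Set.Icc (p₀ - 2 * s) (p₀ + 2 * s) := fun t ht =>
      stretch_mem_Icc hb hbs ⟨by linarith [(abs_le.1 ht).1], by linarith [(abs_le.1 ht).2]⟩
    have h := hconv _ (hmem q hq') _ (hmem p hp') ((strictMono_stretch hb hs).monotone hqp)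
    rw [deriv_comp_stretch hdf, deriv_comp_stretch hdf, stretchDeriv_of_abs_le hb hbs hq',
      stretchDeriv_of_abs_le hb hbs hp', ← sub_mul]
    have hd : stretch p₀ s b p - stretch p₀ s b q = (1 + s / b) / 2 * (p - q) := by
      rw [stretch_of_abs_le hb hbs hq', stretch_of_abs_le hb hbs hp']; ring
    rw [hd] at h
    have hlam : s / (2 * b) ≤ (1 + s / b) / 2 := by
      rw [show s / (2 * b) = s / b / 2 by field_simp]; linarith
    calc c * (s / (2 * b)) ^ 2 * (p - q) ≤ c * ((1 + s / b) / 2) ^ 2 * (p - q) := by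
          have : 0 ≤ p - q := by linarith
          gcongr
      _ = c * ((1 + s / b) / 2 * (p - q)) * ((1 + s / b) / 2) := by ring
      _ ≤ _ := mul_le_mul_of_nonneg_right h (by positivity)
  · intro p hp
    rw [abs_le] at hp
    have hpI : p ∈ Set.Icc (p₀ - 2 * s) (p₀ + 2 * s) := ⟨by linarith, by linarith⟩
    have hqI := stretch_mem_Icc hb hbs hpI
    have hpos := stretchDeriv_pos (p₀ := p₀) hb hs p
    rw [deriv_comp_stretch hdf]
    rcases le_total p₀ p with h | h
    · have hq := (strictMono_stretch (p₀ := p₀) hb hs).monotone h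
      rw [stretch_center hb hbs] at hq
      have h1 := hconv _ hp₀ _ hqI hq
      have h2 : 0 ≤ deriv f (stretch p₀ s b p) := by nlinarith
      exact mul_nonneg (mul_nonneg h2 hpos.le) (by linarith)
    · have hq := (strictMono_stretch (p₀ := p₀) hb hs).monotone h
      rw [stretch_center hb hbs] at hq
      have h1 := hconv _ hqI _ hp₀ hq
      have h2 : deriv f (stretch p₀ s b p) ≤ 0 := by nlinarith
      exact mul_nonneg_of_nonpos_of_nonpos (mul_nonpos_of_nonpos_of_nonneg h2 hpos.le) (by linarith)
  · have hm : MeasurableSet {p : ℝ | 2 * s < |p - p₀|} :=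
      measurableSet_lt measurable_const (by fun_prop)
    rw [setIntegral_congr_fun (g := fun p => |deriv f p|) hm fun p hp => by
      simp only
      rw [deriv_comp_stretch_of_le_abs hdf hb hbs (le_of_lt hp)]]
    exact setIntegral_le_integral hf'.abs (.of_forall fun p => abs_nonneg _)
  · have h1 : 2 / (2 * s) * L = L / s := by field_simp
    have h2 : c * (s / (2 * b)) ^ 2 * (b / 2) / 4 = c * s ^ 2 / (32 * b) := by field_simp; ring
    rw [h1, h2, div_lt_div_iff₀ hs (by positivity)]
    nlinarith

end

/-- An equilibrium with more than one (nondegenerate) critical point is structurally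
unstable under dynamically accessible (monotone rearrangement) perturbations. -/
theorem structural_instability_dynamically_accessible
    (f₀ : ℝ → ℝ)
    (hnn : ∀ p, 0 ≤ f₀ p)
    (hint : Integrable f₀)
    (hC2 : ContDiff ℝ 2 f₀)
    (hint' : Integrable (deriv f₀))
    (hdecay : Tendsto f₀ (cocompact ℝ) (nhds 0))
    (hfin : {p : ℝ | deriv f₀ p = 0}.Finite)
    (hmany : 1 < hfin.toFinset.card)
    (hnondeg : ∀ p, deriv f₀ p = 0 → deriv (deriv f₀) p ≠ 0) :
    ∀ δ : ℝ, 0 < δ →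
      ∃ phat : ℝ → ℝ,
        ContDiff ℝ 1 phat ∧ Function.Bijective phat ∧
        (∀ p, 0 < deriv phat p) ∧ StrictMono phat ∧
        (∫ p : ℝ, |f₀ (phat p) - f₀ p|) +
          (∫ p : ℝ, |deriv (f₀ ∘ phat) p - deriv f₀ p|) < δ ∧
        ∃ k : ℝ, 0 < k ∧ ∃ z : ℂ, 0 < z.im ∧
          eps (deriv (f₀ ∘ phat)) k z = 0 := by
  intro δ hδ
  have hC1 : ContDiff ℝ 1 f₀ := hC2.of_le one_le_two
  have hd1 : ContDiff ℝ 1 (deriv f₀) := hC2.deriv'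
  have hd1c := hd1.continuous
  obtain ⟨p₀, h0, h0'⟩ := exists_eq_zero_and_deriv_pos hd1c hfin hmany hnondeg
  obtain ⟨ρ, hρ, hball⟩ := Metric.eventually_nhds_iff_ball.1
    ((hd1.continuous_deriv le_rfl).continuousAt.eventually_const_lt (half_lt_self h0'))
  obtain ⟨B₁, hB₁⟩ := isCompact_Icc.exists_bound_of_continuousOn
    (hC1.continuous.continuousOn (s := Set.Icc (p₀ - ρ) (p₀ + ρ)))
  obtain ⟨B₂, hB₂⟩ := isCompact_Icc.exists_bound_of_continuousOn
    (hd1c.continuousOn (s := Set.Icc (p₀ - ρ) (p₀ + ρ)))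
  obtain ⟨B, hB, hBB₁, hBB₂⟩ : ∃ B : ℝ, 0 < B ∧ B₁ ≤ B ∧ B₂ ≤ B :=
    ⟨max 1 (max B₁ B₂), by positivity, by simp, by simp⟩
  obtain ⟨s, hs, hsρ, hsδ⟩ : ∃ s : ℝ, 0 < s ∧ 2 * s ≤ ρ ∧ 16 * s * B < δ := by
    refine ⟨min (ρ / 2) (δ / (32 * B)), by positivity, ?_, ?_⟩
    · linarith [min_le_left (ρ / 2) (δ / (32 * B))]
    · have := min_le_right (ρ / 2) (δ / (32 * B))
      rw [le_div_iff₀ (by positivity)] at this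
      linarith
  have hsub : Set.Icc (p₀ - 2 * s) (p₀ + 2 * s) ⊆ Set.Icc (p₀ - ρ) (p₀ + ρ) :=
    Set.Icc_subset_Icc (by linarith) (by linarith)
  obtain ⟨b, hb, hbs, hunstable⟩ := exists_eps_deriv_comp_stretch_eq_zero hC1 hint' h0
    (half_pos h0') hs <| (convex_Icc _ _).mul_sub_le_image_sub_of_le_deriv hd1c.continuousOn
      (hd1.differentiable one_ne_zero).differentiableOn fun p hp => by
        rw [interior_Icc] at hp
        refine (hball p ?_).le
        rw [Real.ball_eq_Ioo]
        exact ⟨by linarith [hp.1], by linarith [hp.2]⟩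
  refine ⟨stretch p₀ s b, contDiff_stretch p₀ s b, bijective_stretch hb hbs, fun p => ?_,
    strictMono_stretch hb hs, ?_, hunstable⟩
  · rw [deriv_stretch]; exact stretchDeriv_pos hb hs p
  · have h1 := integral_abs_comp_stretch_sub_le hC1.continuous hb hbs
      fun p hp => (hB₁ p (hsub hp)).trans hBB₁
    have h2 := integral_abs_deriv_comp_stretch_sub_le hC1 hb hbs
      fun p hp => (hB₂ p (hsub hp)).trans hBB₂
    linarith
end

section
/- Single-humped equilibria are spectrally stable: let g : ℝ → ℝ be locally absolutely continuous and integrable with integrable derivative g', and suppose there exists p₀ ∈ ℝ such that (p₀ − p)·g'(p) ≥ 0 for all p (g is nondecreasing on (−∞,p₀] and nonincreasing on [p₀,∞)). Then for every k ≠ 0 and every z ∈ ℂ with Im z > 0, ε_{g'}(k,z) ≠ 0. -/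
open MeasureTheory Filter

theorem LocAbsCont.integral_eq_zero {f f' : ℝ → ℝ} (hac : LocAbsCont f f')
    (hf : Integrable f) (hf' : Integrable f') : ∫ p, f' p = 0 := by
  have htop : Tendsto f atTop (nhds (f 0 + ∫ t in Set.Ioi 0, f' t)) := by
    refine ((intervalIntegral_tendsto_integral_Ioi 0 hf'.integrableOn tendsto_id).const_add
      (f 0)).congr fun b => ?_
    rw [id, ← hac.2 0 b]
    ring
  have hbot : Tendsto f atBot (nhds (f 0 - ∫ t in Set.Iic 0, f' t)) := by
    refine ((intervalIntegral_tendsto_integral_Iic 0 hf'.integrableOn tendsto_id).const_sub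
      (f 0)).congr fun a => ?_
    rw [id, ← hac.2 a 0]
    ring
  have h₁ := (hf.integrableAtFilter atTop).eq_zero_of_tendsto
    (fun s hs => by
      obtain ⟨b, hb⟩ := mem_atTop_sets.1 hs
      exact top_le_iff.1 (Real.volume_Ici (a := b) ▸ measure_mono hb)) htop
  have h₂ := (hf.integrableAtFilter atBot).eq_zero_of_tendsto
    (fun s hs => by
      obtain ⟨b, hb⟩ := mem_atBot_sets.1 hs
      exact top_le_iff.1 (Real.volume_Iic (a := b) ▸ measure_mono hb)) hbot
  rw [← intervalIntegral.integral_Iic_add_Ioi hf'.integrableOn hf'.integrableOn (b := 0)]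
  linarith

theorem sub_ofReal_ne_zero {z : ℂ} (hz : 0 < z.im) (p : ℝ) : z - p ≠ 0 := fun h =>
  hz.ne' (by simpa using congrArg Complex.im h)

theorem integrable_ofReal_div_sub {f : ℝ → ℝ} (hf : Integrable f) {z : ℂ} (hz : 0 < z.im) :
    Integrable fun p : ℝ => (f p : ℂ) / (z - p) := by
  have hcont : Continuous fun p : ℝ => (z - (p : ℂ))⁻¹ := Continuous.inv₀ (by fun_prop) (sub_ofReal_ne_zero hz)
  simp only [div_eq_mul_inv]
  refine hf.ofReal.mul_bdd (c := z.im⁻¹) hcont.aestronglyMeasurable (ae_of_all _ fun p => ?_)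
  rw [norm_inv]
  refine inv_anti₀ hz ?_
  simpa using (le_abs_self _).trans (Complex.abs_im_le_norm (z - p))

/-- Single-humped equilibria are spectrally stable: if `g` is nondecreasing on
`(-∞, p₀]` and nonincreasing on `[p₀, ∞)`, then `ε_{g'}(k,·)` has no zero in the
upper half plane. -/
theorem single_hump_spectrally_stable
    (g g' : ℝ → ℝ)
    (hac : LocAbsCont g g')
    (hg : Integrable g)
    (hg' : Integrable g')
    (p₀ : ℝ)
    (hhump : ∀ p, 0 ≤ (p₀ - p) * g' p) :
    ∀ k : ℝ, k ≠ 0 → ∀ z : ℂ, 0 < z.im → eps g' k z ≠ 0 := by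
  intro k hk z hz heps
  have hgC : Integrable fun p : ℝ => (g' p : ℂ) := hg'.ofReal
  have hint := integrable_ofReal_div_sub hg' hz
  have hI : ∫ p : ℝ, (g' p : ℂ) / (z - p) = -(k : ℂ) ^ 2 := by
    have hk' : (k : ℂ) ≠ 0 := by exact_mod_cast hk
    unfold eps at heps
    field_simp at heps
    linear_combination heps
  have hzero : ∫ p, (g' p : ℂ) = 0 := by
    rw [integral_complex_ofReal, hac.integral_eq_zero hg hg', Complex.ofReal_zero]
  have hfun : (fun p : ℝ => (((p₀ - p) * g' p : ℝ) : ℂ) / (z - p)) =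
      fun p : ℝ => (g' p : ℂ) - (z - p₀) * ((g' p : ℂ) / (z - p)) := by
    funext p
    have := sub_ofReal_ne_zero hz p
    push_cast
    field_simp
    ring
  have hw : Integrable fun p : ℝ => (((p₀ - p) * g' p : ℝ) : ℂ) / (z - p) := by
    rw [hfun]
    exact hgC.sub (hint.const_mul _)
  have hval : ∫ p : ℝ, (((p₀ - p) * g' p : ℝ) : ℂ) / (z - p) = (z - p₀) * (k : ℂ) ^ 2 := by
    rw [hfun, integral_sub hgC (hint.const_mul _), integral_const_mul, hI, hzero]
    ring
  have him : ∫ p : ℝ, ((((p₀ - p) * g' p : ℝ) : ℂ) / (z - p)).im = z.im * k ^ 2 := by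
    have h := integral_im hw
    rw [hval] at h
    refine h.trans ?_
    rw [← Complex.ofReal_pow, RCLike.im_eq_complex_im, Complex.im_mul_ofReal]
    simp
  have hnonpos : ∫ p : ℝ, ((((p₀ - p) * g' p : ℝ) : ℂ) / (z - p)).im ≤ 0 := by
    refine integral_nonpos fun p => ?_
    rw [div_eq_mul_inv, Complex.im_ofReal_mul, Complex.inv_im, Complex.sub_im, Complex.ofReal_im,
      sub_zero]
    exact mul_nonpos_of_nonneg_of_nonpos (hhump p)
      (div_nonpos_of_nonpos_of_nonneg (neg_nonpos.2 hz.le) (Complex.normSq_nonneg _))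
  have : 0 < z.im * k ^ 2 := by positivity
  linarith
end

section
/- Eigenvalues off the real axis correspond exactly to zeros of the dispersion function: let k ≠ 0, let g : ℝ → ℝ be integrable and not almost everywhere zero, and let u ∈ ℂ with Im u ≠ 0. Then there exists a nonzero ζ ∈ L¹(ℝ;ℂ) with p ↦ p·ζ(p) integrable satisfying, for almost every p, −ikp·ζ(p) + (i g(p)/k)·∫_ℝ ζ(p̄) dp̄ = −iku·ζ(p), if and only if ε_g(k,u) = 0; in that case ζ(p) = g(p)/(p − u) (up to a nonzero multiplicative constant) is such an eigenfunction. -/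
open MeasureTheory Filter

theorem ofReal_sub_ne_zero_of_im_ne_zero {u : ℂ} (hu : u.im ≠ 0) (p : ℝ) : (p : ℂ) - u ≠ 0 := by
  intro h
  apply hu
  simpa using congrArg Complex.im h

theorem integrable_div_ofReal_sub {g : ℝ → ℝ} (hg : Integrable g) {u : ℂ} (hu : u.im ≠ 0) :
    Integrable (fun p : ℝ => (g p : ℂ) / (p - u)) := by
  have hcont : Continuous (fun p : ℝ => ((p : ℂ) - u)⁻¹) :=
    (Complex.continuous_ofReal.sub continuous_const).inv₀ (ofReal_sub_ne_zero_of_im_ne_zero hu)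
  simp only [div_eq_mul_inv]
  refine hg.ofReal.mul_bdd (c := |u.im|⁻¹) hcont.aestronglyMeasurable (.of_forall fun p => ?_)
  rw [norm_inv]
  refine inv_anti₀ (abs_pos.mpr hu) ?_
  simpa using Complex.abs_im_le_norm ((p : ℂ) - u)

theorem integrable_mul_div_ofReal_sub {g : ℝ → ℝ} (hg : Integrable g) {u : ℂ} (hu : u.im ≠ 0) :
    Integrable (fun p : ℝ => (p : ℂ) * ((g p : ℂ) / (p - u))) := by
  refine (hg.ofReal.add ((integrable_div_ofReal_sub hg hu).const_mul u)).congr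
    (.of_forall fun p => ?_)
  have := ofReal_sub_ne_zero_of_im_ne_zero hu p
  simp only [Pi.add_apply, Complex.coe_algebraMap]
  field_simp
  ring

theorem eps_eq_zero_iff {g : ℝ → ℝ} {k : ℝ} (hk : k ≠ 0) (u : ℂ) :
    eps g k u = 0 ↔ ∫ p : ℝ, (g p : ℂ) / (p - u) = (k : ℂ) ^ 2 := by
  have hk' : (k : ℂ) ≠ 0 := Complex.ofReal_ne_zero.mpr hk
  have hneg : ∫ p : ℝ, (g p : ℂ) / (u - p) = -∫ p : ℝ, (g p : ℂ) / (p - u) := by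
    rw [← integral_neg]
    congr 1 with p
    rw [← div_neg, neg_sub]
  rw [eps, hneg, mul_neg, ← sub_eq_add_neg, sub_eq_zero, one_div, eq_inv_mul_iff_mul_eq₀
    (pow_ne_zero 2 hk'), mul_one, eq_comm]

/-- The pointwise eigenvalue equation, with `S` in place of `∫ ζ`, solved for `z = ζ(p)`. -/
theorem eigenvalue_equation_iff {k : ℝ} (hk : k ≠ 0) {u : ℂ} (hu : u.im ≠ 0) (p : ℝ) (a z S : ℂ) :
    -(Complex.I * k * p) * z + (Complex.I * a / k) * S = -(Complex.I * k * u) * z ↔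
      z = S / (k : ℂ) ^ 2 * (a / (p - u)) := by
  have hk' : (k : ℂ) ≠ 0 := Complex.ofReal_ne_zero.mpr hk
  have hp := ofReal_sub_ne_zero_of_im_ne_zero hu p
  have key : -(Complex.I * k * p) * z + (Complex.I * a / k) * S - -(Complex.I * k * u) * z =
      -(Complex.I * k * (p - u)) * (z - S / (k : ℂ) ^ 2 * (a / (p - u))) := by
    field_simp
    ring
  rw [← sub_eq_zero, key, mul_eq_zero, sub_eq_zero, or_iff_right]
  exact neg_ne_zero.mpr (mul_ne_zero (mul_ne_zero Complex.I_ne_zero hk') hp)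

/-- Eigenvalues off the real axis correspond exactly to zeros of the dispersion
function, with eigenfunction `ζ(p) = g(p)/(p − u)`. -/
theorem eigenvalue_iff_dispersion_zero
    (k : ℝ) (hk : k ≠ 0) (g : ℝ → ℝ) (hg : Integrable g)
    (hgne : ¬ (∀ᵐ p : ℝ, g p = 0)) (u : ℂ) (hu : u.im ≠ 0) :
    ((∃ ζ : ℝ → ℂ,
        Integrable ζ ∧ ¬ (∀ᵐ p : ℝ, ζ p = 0) ∧
        Integrable (fun p : ℝ => (p : ℂ) * ζ p) ∧
        (∀ᵐ p : ℝ, -(Complex.I * k * p) * ζ p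
            + (Complex.I * (g p) / k) * (∫ q : ℝ, ζ q)
          = -(Complex.I * k * u) * ζ p)) ↔ eps g k u = 0)
    ∧ (eps g k u = 0 →
        Integrable (fun p : ℝ => (g p : ℂ) / (p - u)) ∧
        ¬ (∀ᵐ p : ℝ, (g p : ℂ) / (p - u) = 0) ∧
        Integrable (fun p : ℝ => (p : ℂ) * ((g p : ℂ) / (p - u))) ∧
        (∀ᵐ p : ℝ, -(Complex.I * k * p) * ((g p : ℂ) / (p - u))
            + (Complex.I * (g p) / k) * (∫ q : ℝ, (g q : ℂ) / (q - u))
          = -(Complex.I * k * u) * ((g p : ℂ) / (p - u)))) := by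
  have hk' : (k : ℂ) ^ 2 ≠ 0 := pow_ne_zero 2 (Complex.ofReal_ne_zero.mpr hk)
  have hback : eps g k u = 0 →
      Integrable (fun p : ℝ => (g p : ℂ) / (p - u)) ∧
      ¬ (∀ᵐ p : ℝ, (g p : ℂ) / (p - u) = 0) ∧
      Integrable (fun p : ℝ => (p : ℂ) * ((g p : ℂ) / (p - u))) ∧
      (∀ᵐ p : ℝ, -(Complex.I * k * p) * ((g p : ℂ) / (p - u))
          + (Complex.I * (g p) / k) * (∫ q : ℝ, (g q : ℂ) / (q - u))
        = -(Complex.I * k * u) * ((g p : ℂ) / (p - u))) := by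
    intro h
    refine ⟨integrable_div_ofReal_sub hg hu, fun h0 => hgne ?_,
      integrable_mul_div_ofReal_sub hg hu, .of_forall fun p => ?_⟩
    · filter_upwards [h0] with p hp
      simpa [ofReal_sub_ne_zero_of_im_ne_zero hu p] using hp
    · rw [eigenvalue_equation_iff hk hu, (eps_eq_zero_iff hk u).mp h, div_self hk', one_mul]
  refine ⟨⟨?_, fun h => ⟨_, hback h⟩⟩, hback⟩
  rintro ⟨ζ, -, hne, -, heq⟩
  simp only [eigenvalue_equation_iff hk hu] at heq
  have hS : ∫ q, ζ q ≠ 0 := by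
    intro h0
    apply hne
    filter_upwards [heq] with p hp
    rw [hp, h0, zero_div, zero_mul]
  have hint := integral_congr_ae heq
  rw [integral_const_mul, div_mul_eq_mul_div, eq_div_iff hk'] at hint
  exact (eps_eq_zero_iff hk u).mpr (mul_left_cancel₀ hS hint).symm
end

section
/- The continuous spectrum of the linearized Vlasov–Poisson operator fills the imaginary axis: let k ≠ 0 and let g : ℝ → ℝ be integrable. For every u ∈ ℝ there exists a sequence (ζ_n) in L¹(ℝ;ℂ) with ∫_ℝ|ζ_n| = 1, p ↦ p·ζ_n(p) integrable, and ∫_ℝ ζ_n = 0, such that ∫_ℝ | −ikp·ζ_n(p) + (i g(p)/k)·∫_ℝ ζ_n + iku·ζ_n(p) | dp → 0 as n → ∞; hence −iku is an approximate eigenvalue of the operator ζ ↦ −ikp·ζ + (i g/k)∫ζ, which is therefore not bounded below by any positive constant after subtracting −iku. -/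
open MeasureTheory Filter

/-- A unit-mass, mean-zero integrable function supported within distance `a` of `u`. -/
theorem exists_integrable_norm_one_integral_zero_supported (u : ℝ) {a : ℝ} (ha : 0 < a) :
    ∃ ζ : ℝ → ℂ, Integrable ζ ∧ (∫ p : ℝ, ‖ζ p‖) = 1 ∧ (∫ p : ℝ, ζ p) = 0 ∧
      ∀ p, a < |p - u| → ζ p = 0 := by
  set c : ℂ := ((1 / (2 * a) : ℝ) : ℂ) with hc
  have hcn : ‖c‖ = 1 / (2 * a) := by
    rw [hc, Complex.norm_real, Real.norm_of_nonneg (by positivity)]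
  have hR : Integrable ((Set.Ioc u (u + a)).indicator fun _ => c) :=
    (integrable_indicator_iff measurableSet_Ioc).2 (integrableOn_const (by simp))
  have hL : Integrable ((Set.Ioc (u - a) u).indicator fun _ => c) :=
    (integrable_indicator_iff measurableSet_Ioc).2 (integrableOn_const (by simp))
  refine ⟨fun p => (Set.Ioc u (u + a)).indicator (fun _ => c) p
    - (Set.Ioc (u - a) u).indicator (fun _ => c) p, hR.sub hL, ?_, ?_, ?_⟩
  · have h : (fun p => ‖(Set.Ioc u (u + a)).indicator (fun _ => c) p
        - (Set.Ioc (u - a) u).indicator (fun _ => c) p‖)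
        = (Set.Ioc (u - a) (u + a)).indicator fun _ => 1 / (2 * a) := by
      funext p
      simp only [Set.indicator_apply, Set.mem_Ioc]
      split_ifs <;> first | (exfalso; grind) | simp [hcn]
    rw [h, integral_indicator measurableSet_Ioc, setIntegral_const]
    simp only [Measure.real, Real.volume_Ioc, smul_eq_mul]
    rw [ENNReal.toReal_ofReal (by linarith)]
    field_simp
    ring
  · rw [integral_sub hR hL, integral_indicator measurableSet_Ioc,
      integral_indicator measurableSet_Ioc, setIntegral_const, setIntegral_const]
    simp [Measure.real]
  · intro p hp
    have h₁ : p ∉ Set.Ioc u (u + a) := by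
      rintro ⟨h, h'⟩
      exact hp.not_ge (abs_le.2 ⟨by linarith, by linarith⟩)
    have h₂ : p ∉ Set.Ioc (u - a) u := by
      rintro ⟨h, h'⟩
      exact hp.not_ge (abs_le.2 ⟨by linarith, by linarith⟩)
    simp [h₁, h₂]

/-- Multiplication by `p - u` costs at most a factor `a` on functions supported within
distance `a` of `u`. -/
theorem norm_sub_mul_le_of_supported {u a : ℝ} {ζ : ℝ → ℂ}
    (h : ∀ p, a < |p - u| → ζ p = 0) (p : ℝ) : ‖((p : ℂ) - u) * ζ p‖ ≤ a * ‖ζ p‖ := by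
  rw [norm_mul, ← Complex.ofReal_sub, Complex.norm_real, Real.norm_eq_abs]
  rcases le_or_gt |p - u| a with hp | hp
  · gcongr
  · simp [h p hp]

theorem integrable_sub_mul_of_supported {u a : ℝ} {ζ : ℝ → ℂ} (hζ : Integrable ζ)
    (h : ∀ p, a < |p - u| → ζ p = 0) : Integrable fun p : ℝ => ((p : ℂ) - u) * ζ p :=
  (hζ.norm.const_mul a).mono'
    ((by fun_prop : Continuous fun p : ℝ => (p : ℂ) - u).aestronglyMeasurable.mul
      hζ.aestronglyMeasurable)
    (Eventually.of_forall (norm_sub_mul_le_of_supported h))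

/-- The continuous spectrum of the linearized Vlasov–Poisson operator fills the
imaginary axis: for every real `u`, `−iku` is an approximate eigenvalue of
`ζ ↦ −ikp·ζ + (i g/k)∫ζ`. -/
theorem continuous_spectrum_approx_eigenvalue
    (k : ℝ) (hk : k ≠ 0) (g : ℝ → ℝ) (hg : Integrable g) :
    ∀ u : ℝ, ∃ ζ : ℕ → ℝ → ℂ,
      (∀ n, Integrable (ζ n) ∧ (∫ p : ℝ, ‖ζ n p‖) = 1 ∧
        Integrable (fun p : ℝ => (p : ℂ) * ζ n p) ∧ (∫ p : ℝ, ζ n p) = 0) ∧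
      Tendsto (fun n =>
          ∫ p : ℝ, ‖-(Complex.I * k * p) * ζ n p
            + (Complex.I * (g p) / k) * (∫ q : ℝ, ζ n q)
            + (Complex.I * k * u) * ζ n p‖)
        atTop (nhds 0) := by
  intro u
  choose ζ hint hnorm hzero hsupp using fun n : ℕ =>
    exists_integrable_norm_one_integral_zero_supported u (Nat.one_div_pos_of_nat (α := ℝ) (n := n))
  refine ⟨ζ, fun n => ⟨hint n, hnorm n, ?_, hzero n⟩, ?_⟩
  · refine ((integrable_sub_mul_of_supported (hint n) (hsupp n)).add
      ((hint n).const_mul (u : ℂ))).congr (Eventually.of_forall fun p => ?_)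
    simp only [Pi.add_apply]
    ring
  · have hlim : Tendsto (fun n : ℕ => |k| * (1 / ((n : ℝ) + 1))) atTop (nhds 0) := by
      simpa using tendsto_one_div_add_atTop_nhds_zero_nat.const_mul |k|
    refine squeeze_zero (fun n => integral_nonneg fun p => norm_nonneg _) (fun n => ?_) hlim
    have h : ∀ p : ℝ, ‖-(Complex.I * k * p) * ζ n p
        + (Complex.I * (g p) / k) * (∫ q : ℝ, ζ n q) + (Complex.I * k * u) * ζ n p‖
        = |k| * ‖((p : ℂ) - u) * ζ n p‖ := by
      intro p
      rw [hzero n, show -(Complex.I * k * p) * ζ n p + (Complex.I * (g p) / k) * 0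
        + (Complex.I * k * u) * ζ n p = -(Complex.I * k) * (((p : ℂ) - u) * ζ n p) by ring,
        norm_mul]
      simp
    simp only [h]
    rw [integral_const_mul]
    gcongr
    calc ∫ p : ℝ, ‖((p : ℂ) - u) * ζ n p‖
        ≤ ∫ p : ℝ, 1 / ((n : ℝ) + 1) * ‖ζ n p‖ :=
          integral_mono (integrable_sub_mul_of_supported (hint n) (hsupp n)).norm
            ((hint n).norm.const_mul _) (norm_sub_mul_le_of_supported (hsupp n))
      _ = 1 / ((n : ℝ) + 1) := by rw [integral_const_mul, hnorm n, mul_one]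
end

section
/- Homogeneity-preserving area-preserving maps of a finite cylinder are trivial in the momentum direction: let L > 0, let φ : ℝ × ℝ → ℝ be differentiable in its first argument with φ(q+L, p) = φ(q, p) + L for all (q,p), let ψ : ℝ → ℝ be differentiable, and suppose the Jacobian condition (∂φ/∂q)(q,p) · ψ'(p) = 1 holds for all (q,p). Then ψ'(p) = 1 for all p. -/
/-- Homogeneity-preserving area-preserving maps of a finite cylinder are trivial in
the momentum direction: if `φ(q+L,p) = φ(q,p)+L` and `(∂φ/∂q)·ψ' = 1`, then `ψ' ≡ 1`. -/
theorem finite_domain_no_homogeneous_rearrangement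
    (L : ℝ) (hL : 0 < L)
    (φ φq : ℝ → ℝ → ℝ) (ψ ψ' : ℝ → ℝ)
    (hφ : ∀ q p : ℝ, HasDerivAt (fun q' => φ q' p) (φq q p) q)
    (hper : ∀ q p : ℝ, φ (q + L) p = φ q p + L)
    (hψ : ∀ p : ℝ, HasDerivAt ψ (ψ' p) p)
    (hjac : ∀ q p : ℝ, φq q p * ψ' p = 1) :
    ∀ p : ℝ, ψ' p = 1 := by
  intro p
  obtain ⟨c, -, hc⟩ := exists_hasDerivAt_eq_slope (fun q => φ q p) (fun q => φq q p) hL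
    (fun q _ => (hφ q p).continuousAt.continuousWithinAt) (fun q _ => hφ q p)
  have hslope : φq c p = 1 := by
    have h := hper 0 p
    rw [zero_add] at h
    rw [hc, h, sub_zero, add_sub_cancel_left, div_self hL.ne']
  simpa [hslope] using hjac c p
end

section
/- Existence of a monotone rearrangement between functions with matching critical structure: let n ≥ 1, let f, g : ℝ → ℝ be continuous, and let d₁ < d₂ < ⋯ < d_n and c₁ < c₂ < ⋯ < c_n be real numbers such that f is strictly monotone on each of the intervals (−∞, d₁], [d₁, d₂], …, [d_n, ∞), g is strictly monotone on each of (−∞, c₁], [c₁, c₂], …, [c_n, ∞), with f increasing on the i-th interval if and only if g is increasing on the i-th interval; suppose f(d_i) = g(c_i) for every i, lim_{p→−∞} f(p) = lim_{p→−∞} g(p), and lim_{p→+∞} f(p) = lim_{p→+∞} g(p) (limits taken in [−∞, +∞]). Then there exists a strictly increasing continuous bijection p̂ : ℝ → ℝ with p̂(c_i) = d_i for all i and f(p̂(p)) = g(p) for every p ∈ ℝ. -/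
open Filter

/-- The `i`-th monotonicity interval determined by the critical points
`d 1 < d 2 < ⋯ < d n` (indices `1,…,n`): for `i = 0` it is `(-∞, d 1]`, for
`0 < i < n` it is `[d i, d (i+1)]`, and for `i = n` it is `[d n, ∞)`. -/
def seg (n : ℕ) (d : ℕ → ℝ) (i : ℕ) : Set ℝ :=
  if i = 0 then Set.Iic (d 1)
  else if i = n then Set.Ici (d n)
  else Set.Icc (d i) (d (i + 1))

/-- `φ` is a strictly increasing map of `S` onto `T` that carries `f` on `T` to `g` on `S`. -/
structure IsRearrangementOn (f g φ : ℝ → ℝ) (S T : Set ℝ) : Prop where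
  strictMonoOn : StrictMonoOn φ S
  image_eq : φ '' S = T
  comp_eq : ∀ p ∈ S, f (φ p) = g p

namespace IsRearrangementOn

variable {f g φ ψ : ℝ → ℝ} {S S' T T' : Set ℝ} {a b : ℝ}

lemma apply_isGreatest (h : IsRearrangementOn f g φ S T) (ha : IsGreatest S a)
    (hb : IsGreatest T b) : φ a = b := by
  have h1 := h.strictMonoOn.monotoneOn.map_isGreatest ha
  rw [h.image_eq] at h1
  exact h1.unique hb

lemma apply_isLeast (h : IsRearrangementOn f g φ S T) (ha : IsLeast S a)
    (hb : IsLeast T b) : φ a = b := by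
  have h1 := h.strictMonoOn.monotoneOn.map_isLeast ha
  rw [h.image_eq] at h1
  exact h1.unique hb

lemma congr (h : IsRearrangementOn f g φ S T) (hψ : Set.EqOn ψ φ S) :
    IsRearrangementOn f g ψ S T :=
  ⟨h.strictMonoOn.congr hψ.symm, hψ.image_eq.trans h.image_eq,
    fun p hp => by rw [hψ hp, h.comp_eq p hp]⟩

/-- Rearrangements of two adjacent pieces glue together. -/
lemma union (h : IsRearrangementOn f g φ S T) (h' : IsRearrangementOn f g ψ S' T')
    (ha : IsGreatest S a) (ha' : IsLeast S' a) (hb : IsGreatest T b) (hb' : IsLeast T' b) :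
    ∃ χ, Set.EqOn χ φ S ∧ IsRearrangementOn f g χ (S ∪ S') (T ∪ T') := by
  classical
  have e : Set.EqOn (S.piecewise φ ψ) φ S := Set.piecewise_eqOn S φ ψ
  have e' : Set.EqOn (S.piecewise φ ψ) ψ S' := by
    intro p hp
    by_cases hpS : p ∈ S
    · have hpa : p = a := le_antisymm (ha.2 hpS) (ha'.2 hp)
      rw [e hpS, hpa, h.apply_isGreatest ha hb, h'.apply_isLeast ha' hb']
    · exact Set.piecewise_eq_of_notMem S φ ψ hpS
  have k := h.congr e
  have k' := h'.congr e'
  refine ⟨S.piecewise φ ψ, e, k.strictMonoOn.union k'.strictMonoOn ha ha', ?_, ?_⟩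
  · rw [Set.image_union, k.image_eq, k'.image_eq]
  · rintro p (hp | hp)
    exacts [k.comp_eq p hp, k'.comp_eq p hp]

end IsRearrangementOn

lemma exists_isRearrangementOn_of_strictMonoOn {f g : ℝ → ℝ} {S T : Set ℝ}
    (hf : StrictMonoOn f T) (hg : StrictMonoOn g S) (h : f '' T = g '' S) :
    ∃ φ, IsRearrangementOn f g φ S T := by
  have key : ∀ p, ∃ x, p ∈ S → x ∈ T ∧ f x = g p := by
    intro p
    by_cases hp : p ∈ S
    · obtain ⟨x, hx, hxp⟩ : g p ∈ f '' T := h ▸ Set.mem_image_of_mem g hp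
      exact ⟨x, fun _ => ⟨hx, hxp⟩⟩
    · exact ⟨0, fun h => absurd h hp⟩
  choose φ hφ using key
  refine ⟨φ, ?_, ?_, fun p hp => (hφ p hp).2⟩
  · intro p hp q hq hpq
    rw [← hf.lt_iff_lt (hφ p hp).1 (hφ q hq).1, (hφ p hp).2, (hφ q hq).2]
    exact hg hp hq hpq
  · ext x
    constructor
    · rintro ⟨p, hp, rfl⟩
      exact (hφ p hp).1
    · intro hx
      obtain ⟨p, hp, hpx⟩ : f x ∈ g '' S := h ▸ Set.mem_image_of_mem f hx
      exact ⟨p, hp, hf.injOn (hφ p hp).1 hx ((hφ p hp).2.trans hpx)⟩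

/-- Two functions strictly monotone in the same sense, with the same image, are
rearrangements of each other. -/
lemma exists_isRearrangementOn {f g : ℝ → ℝ} {S T : Set ℝ}
    (hm : (StrictMonoOn f T ∧ StrictMonoOn g S) ∨ (StrictAntiOn f T ∧ StrictAntiOn g S))
    (h : f '' T = g '' S) : ∃ φ, IsRearrangementOn f g φ S T := by
  rcases hm with ⟨hf, hg⟩ | ⟨hf, hg⟩
  · exact exists_isRearrangementOn_of_strictMonoOn hf hg h
  · have h' : (-f) '' T = (-g) '' S := by
      have := congrArg (Neg.neg '' ·) h
      simp only [Set.image_image] at this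
      exact this
    obtain ⟨φ, h1, h2, h3⟩ := exists_isRearrangementOn_of_strictMonoOn hf.neg hg.neg h'
    exact ⟨φ, h1, h2, fun p hp => neg_injective (h3 p hp)⟩

lemma image_Icc_subset {f g : ℝ → ℝ} {a b a' b' : ℝ} (hg : Continuous g)
    (hm : MonotoneOn f (Set.Icc a b) ∨ AntitoneOn f (Set.Icc a b)) (hab : a ≤ b)
    (hab' : a' ≤ b') (ha : f a = g a') (hb : f b = g b') :
    f '' Set.Icc a b ⊆ g '' Set.Icc a' b' := by
  rintro _ ⟨x, hx, rfl⟩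
  have hla := Set.left_mem_Icc.2 hab
  have hrb := Set.right_mem_Icc.2 hab
  rcases hm with hf | hf
  · apply intermediate_value_Icc hab' hg.continuousOn
    rw [← ha, ← hb]
    exact ⟨hf hla hx hx.1, hf hx hrb hx.2⟩
  · apply intermediate_value_Icc' hab' hg.continuousOn
    rw [← ha, ← hb]
    exact ⟨hf hx hrb hx.2, hf hla hx hx.1⟩

lemma image_Ici_subset_of_strictMonoOn {f g : ℝ → ℝ} {a b : ℝ} {L : EReal} (hg : Continuous g)
    (hf : StrictMonoOn f (Set.Ici a)) (hab : f a = g b)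
    (hfL : Tendsto (fun p => (f p : EReal)) atTop (nhds L))
    (hgL : Tendsto (fun p => (g p : EReal)) atTop (nhds L)) :
    f '' Set.Ici a ⊆ g '' Set.Ici b := by
  rintro _ ⟨x, hx, rfl⟩
  have hx' : a ≤ x := hx
  have hlt : (f x : EReal) < L := by
    have h1 : f x < f (x + 1) := hf hx (Set.mem_Ici.2 (by linarith)) (by linarith)
    refine (EReal.coe_lt_coe_iff.2 h1).trans_le (ge_of_tendsto hfL ?_)
    filter_upwards [eventually_ge_atTop (x + 1)] with p hp
    exact EReal.coe_le_coe_iff.2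
      (hf.monotoneOn (Set.mem_Ici.2 (by linarith)) (Set.mem_Ici.2 (by linarith)) hp)
  obtain ⟨p, hp, hbp⟩ :=
    ((hgL.eventually (lt_mem_nhds hlt)).and (eventually_ge_atTop b)).exists
  obtain ⟨q, hq, hqx⟩ : f x ∈ g '' Set.Icc b p :=
    intermediate_value_Icc hbp hg.continuousOn
      ⟨hab ▸ hf.monotoneOn Set.self_mem_Ici hx hx', (EReal.coe_lt_coe_iff.1 hp).le⟩
  exact ⟨q, hq.1, hqx⟩

lemma image_Ici_subset {f g : ℝ → ℝ} {a b : ℝ} {L : EReal} (hg : Continuous g)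
    (hm : StrictMonoOn f (Set.Ici a) ∨ StrictAntiOn f (Set.Ici a)) (hab : f a = g b)
    (hfL : Tendsto (fun p => (f p : EReal)) atTop (nhds L))
    (hgL : Tendsto (fun p => (g p : EReal)) atTop (nhds L)) :
    f '' Set.Ici a ⊆ g '' Set.Ici b := by
  rcases hm with hf | hf
  · exact image_Ici_subset_of_strictMonoOn hg hf hab hfL hgL
  · have h := image_Ici_subset_of_strictMonoOn (f := -f) (g := -g) (L := -L) hg.neg hf.neg
      (congrArg Neg.neg hab)
      (((continuous_neg (G := EReal)).tendsto L).comp hfL)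
      (((continuous_neg (G := EReal)).tendsto L).comp hgL)
    rintro _ ⟨x, hx, rfl⟩
    obtain ⟨q, hq, hqx⟩ := h (Set.mem_image_of_mem (-f) hx)
    exact ⟨q, hq, neg_injective hqx⟩

lemma image_Iic_subset {f g : ℝ → ℝ} {a b : ℝ} {L : EReal} (hg : Continuous g)
    (hm : StrictMonoOn f (Set.Iic a) ∨ StrictAntiOn f (Set.Iic a)) (hab : f a = g b)
    (hfL : Tendsto (fun p => (f p : EReal)) atBot (nhds L))
    (hgL : Tendsto (fun p => (g p : EReal)) atBot (nhds L)) :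
    f '' Set.Iic a ⊆ g '' Set.Iic b := by
  have hmem : ∀ {x : ℝ}, x ∈ Set.Ici (-a) → -x ∈ Set.Iic a := fun hx => neg_le.1 (Set.mem_Ici.1 hx)
  have h := image_Ici_subset (f := fun x => f (-x)) (g := fun x => g (-x)) (a := -a) (b := -b)
    (L := L) (hg.comp continuous_neg)
    (hm.symm.imp (fun hf x hx y hy hxy => hf (hmem hy) (hmem hx) (neg_lt_neg hxy))
      (fun hf x hx y hy hxy => hf (hmem hy) (hmem hx) (neg_lt_neg hxy)))
    (by simpa using hab) (hfL.comp tendsto_neg_atTop_atBot) (hgL.comp tendsto_neg_atTop_atBot)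
  rintro _ ⟨x, hx, rfl⟩
  obtain ⟨q, hq, hqx⟩ := h ⟨-x, neg_le_neg (Set.mem_Iic.1 hx), rfl⟩
  exact ⟨-q, neg_le.1 (Set.mem_Ici.1 hq), by simpa using hqx⟩

/-- Existence of a monotone rearrangement between two continuous functions with
matching critical points, critical values, monotonicity pattern, and limits at
`±∞` (taken in `[-∞, +∞]`). -/
theorem monotone_rearrangement_exists
    (n : ℕ) (hn : 1 ≤ n) (f g : ℝ → ℝ) (d c : ℕ → ℝ)
    (hf : Continuous f) (hg : Continuous g)
    (hd : ∀ i, 1 ≤ i → i < n → d i < d (i + 1))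
    (hc : ∀ i, 1 ≤ i → i < n → c i < c (i + 1))
    (hmono : ∀ i ≤ n,
      (StrictMonoOn f (seg n d i) ∧ StrictMonoOn g (seg n c i)) ∨
      (StrictAntiOn f (seg n d i) ∧ StrictAntiOn g (seg n c i)))
    (hval : ∀ i, 1 ≤ i → i ≤ n → f (d i) = g (c i))
    (hbot : ∃ Lm : EReal,
      Tendsto (fun p => (f p : EReal)) atBot (nhds Lm) ∧
      Tendsto (fun p => (g p : EReal)) atBot (nhds Lm))
    (htop : ∃ Lp : EReal,
      Tendsto (fun p => (f p : EReal)) atTop (nhds Lp) ∧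
      Tendsto (fun p => (g p : EReal)) atTop (nhds Lp)) :
    ∃ phat : ℝ → ℝ,
      StrictMono phat ∧ Continuous phat ∧ Function.Bijective phat ∧
      (∀ i, 1 ≤ i → i ≤ n → phat (c i) = d i) ∧
      ∀ p, f (phat p) = g p := by
  have hmonoc : MonotoneOn c (Set.Icc 1 n) :=
    monotoneOn_of_le_add_one Set.ordConnected_Icc fun j _ hj hj' =>
      (hc j hj.1 (Nat.lt_of_succ_le hj'.2)).le
  have hf' : ∀ i ≤ n, StrictMonoOn f (seg n d i) ∨ StrictAntiOn f (seg n d i) :=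
    fun i hi => (hmono i hi).imp And.left And.left
  have hg' : ∀ i ≤ n, StrictMonoOn g (seg n c i) ∨ StrictAntiOn g (seg n c i) :=
    fun i hi => (hmono i hi).imp And.right And.right
  have seg_zero : ∀ e, seg n e 0 = Set.Iic (e 1) := fun e => if_pos rfl
  have seg_last : ∀ e, seg n e n = Set.Ici (e n) := fun e => by
    rw [seg, if_neg (by omega), if_pos rfl]
  have seg_mid : ∀ e i, 1 ≤ i → i < n → seg n e i = Set.Icc (e i) (e (i + 1)) :=
    fun e i h1 h2 => by rw [seg, if_neg (by omega), if_neg (by omega)]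
  have hleft : ∀ k, 1 ≤ k → k ≤ n → ∃ φ,
      IsRearrangementOn f g φ (Set.Iic (c k)) (Set.Iic (d k)) ∧
        ∀ i, 1 ≤ i → i ≤ k → φ (c i) = d i := by
    intro k hk
    induction k, hk using Nat.le_induction with
    | base =>
      intro h1
      obtain ⟨L, hfL, hgL⟩ := hbot
      have hm := hmono 0 (Nat.zero_le n)
      have hf0 := hf' 0 (Nat.zero_le n)
      have hg0 := hg' 0 (Nat.zero_le n)
      rw [seg_zero] at hf0 hg0
      rw [seg_zero, seg_zero] at hm
      have hv := hval 1 le_rfl h1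
      obtain ⟨φ, hφ⟩ := exists_isRearrangementOn hm
        ((image_Iic_subset hg hf0 hv hfL hgL).antisymm (image_Iic_subset hf hg0 hv.symm hgL hfL))
      refine ⟨φ, hφ, fun i hi hi' => ?_⟩
      obtain rfl : i = 1 := le_antisymm hi' hi
      exact hφ.apply_isGreatest isGreatest_Iic isGreatest_Iic
    | succ k hk ih =>
      intro hkn
      obtain ⟨φ, hφ, hφc⟩ := ih (by omega)
      have hm := hmono k (by omega)
      have hfk := hf' k (by omega)
      have hgk := hg' k (by omega)
      rw [seg_mid _ k hk hkn] at hfk hgk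
      rw [seg_mid _ k hk hkn, seg_mid _ k hk hkn] at hm
      have hdk := (hd k hk hkn).le
      have hck := (hc k hk hkn).le
      have hv := hval k hk (by omega)
      have hv' := hval (k + 1) (by omega) hkn
      obtain ⟨ψ, hψ⟩ := exists_isRearrangementOn hm
        ((image_Icc_subset hg (hfk.imp StrictMonoOn.monotoneOn StrictAntiOn.antitoneOn)
          hdk hck hv hv').antisymm
          (image_Icc_subset hf (hgk.imp StrictMonoOn.monotoneOn StrictAntiOn.antitoneOn)
            hck hdk hv.symm hv'.symm))
      obtain ⟨χ, hχφ, hχ⟩ := hφ.union hψ isGreatest_Iic (isLeast_Icc hck) isGreatest_Iic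
        (isLeast_Icc hdk)
      rw [Set.Iic_union_Icc_eq_Iic hck, Set.Iic_union_Icc_eq_Iic hdk] at hχ
      refine ⟨χ, hχ, fun i hi hi' => ?_⟩
      rcases hi'.eq_or_lt with rfl | hlt
      · exact hχ.apply_isGreatest isGreatest_Iic isGreatest_Iic
      · have hφi := hφc i hi (by omega)
        have hci : c i ∈ Set.Iic (c k) := hmonoc ⟨hi, by omega⟩ ⟨hk, by omega⟩ (by omega)
        rw [hχφ hci, hφi]
  obtain ⟨φ, hφ, hφc⟩ := hleft n hn le_rfl
  obtain ⟨L, hfL, hgL⟩ := htop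
  have hm := hmono n le_rfl
  have hfn := hf' n le_rfl
  have hgn := hg' n le_rfl
  rw [seg_last] at hfn hgn
  rw [seg_last, seg_last] at hm
  have hv := hval n hn le_rfl
  obtain ⟨ψ, hψ⟩ := exists_isRearrangementOn hm
    ((image_Ici_subset hg hfn hv hfL hgL).antisymm (image_Ici_subset hf hgn hv.symm hgL hfL))
  obtain ⟨χ, hχφ, hχ⟩ := hφ.union hψ isGreatest_Iic isLeast_Ici isGreatest_Iic isLeast_Ici
  rw [Set.Iic_union_Ici, Set.Iic_union_Ici] at hχ
  have hχm : StrictMono χ := strictMonoOn_univ.1 hχ.strictMonoOn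
  have hχs : Function.Surjective χ := Set.range_eq_univ.1 (Set.image_univ.symm.trans hχ.image_eq)
  refine ⟨χ, hχm, hχm.monotone.continuous_of_surjective hχs, ⟨hχm.injective, hχs⟩,
    fun i hi hi' => ?_, fun p => hχ.comp_eq p (Set.mem_univ p)⟩
  rw [hχφ (hmonoc ⟨hi, hi'⟩ ⟨hn, le_rfl⟩ hi'), hφc i hi hi']
end

section
/- For the Maxwellian equilibrium the symmetry integral never vanishes: let f₀(p) = e^{−p²}, so f₀'(p) = −2p·e^{−p²}. Then for every u_R ∈ ℝ and every u_I ≠ 0, ∫_ℝ p·f₀'(p) / ( ((u_R−p)² + u_I²)·((u_R+p)² + u_I²) ) dp < 0; in particular this integral is nonzero. -/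
open MeasureTheory

/-- For the Maxwellian equilibrium `f₀(p) = e^{−p²}` (so `f₀'(p) = −2p·e^{−p²}`), the
symmetry integral is always strictly negative, in particular nonzero. -/
theorem maxwellian_symmetry_integral_negative
    (uR uI : ℝ) (huI : uI ≠ 0) :
    Integrable (fun p : ℝ =>
      p * (-2 * p * Real.exp (-p ^ 2)) /
        (((uR - p) ^ 2 + uI ^ 2) * ((uR + p) ^ 2 + uI ^ 2))) ∧
    (∫ p : ℝ,
      p * (-2 * p * Real.exp (-p ^ 2)) /
        (((uR - p) ^ 2 + uI ^ 2) * ((uR + p) ^ 2 + uI ^ 2))) < 0 := by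
  have hI : 0 < uI ^ 2 := by positivity
  have hden : ∀ p : ℝ, 0 < ((uR - p) ^ 2 + uI ^ 2) * ((uR + p) ^ 2 + uI ^ 2) :=
    fun p => by positivity
  set f : ℝ → ℝ := fun p =>
    p * (-2 * p * Real.exp (-p ^ 2)) /
      (((uR - p) ^ 2 + uI ^ 2) * ((uR + p) ^ 2 + uI ^ 2)) with hf
  have hcont : Continuous f :=
    Continuous.div (by fun_prop) (by fun_prop) fun p => (hden p).ne'
  have hneg : ∀ p, -f p = 2 * p ^ 2 * Real.exp (-p ^ 2) /
      (((uR - p) ^ 2 + uI ^ 2) * ((uR + p) ^ 2 + uI ^ 2)) := fun p => by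
    simp only [hf]
    ring
  have hnonneg : ∀ p, 0 ≤ -f p := fun p => by
    rw [hneg]
    positivity
  have hint : Integrable f := by
    refine ((integrable_exp_neg_mul_sq (b := 1 / 2) (by norm_num)).const_mul
      (4 / (uI ^ 2 * uI ^ 2))).mono' hcont.aestronglyMeasurable (.of_forall fun p => ?_)
    rw [← norm_neg, Real.norm_of_nonneg (hnonneg p), hneg, div_mul_eq_mul_div]
    have hsplit : Real.exp (-p ^ 2) * Real.exp (p ^ 2 / 2) = Real.exp (-(1 / 2) * p ^ 2) := by
      rw [← Real.exp_add]
      ring_nf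
    have hle : p ^ 2 ≤ 2 * Real.exp (p ^ 2 / 2) := by
      linarith [Real.add_one_le_exp (p ^ 2 / 2)]
    have hnum : 2 * p ^ 2 * Real.exp (-p ^ 2) ≤ 4 * Real.exp (-(1 / 2) * p ^ 2) := by
      rw [← hsplit]
      nlinarith [mul_le_mul_of_nonneg_right hle (Real.exp_pos (-p ^ 2)).le]
    have hden_le : uI ^ 2 * uI ^ 2 ≤ ((uR - p) ^ 2 + uI ^ 2) * ((uR + p) ^ 2 + uI ^ 2) := by
      gcongr <;> exact le_add_of_nonneg_left (sq_nonneg _)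
    exact div_le_div₀ (by positivity) hnum (by positivity) hden_le
  refine ⟨hint, ?_⟩
  rw [← neg_pos, ← integral_neg]
  refine (integral_pos_iff_support_of_nonneg hnonneg hint.neg).2 ?_
  refine hcont.neg.isOpen_support.measure_pos volume ⟨1, ?_⟩
  rw [Function.mem_support, Pi.neg_apply, hneg]
  positivity
end

section
/- Dispersion relation of the Caldeira–Leggett model with a negative-energy oscillator: let Ω > 0, let f : (0,∞) → ℝ, and let ω ∈ ℂ with ω² ∉ [0,∞), so that x ↦ x·f(x)²/(ω²−x²) has no singularity; assume this function is integrable on (0,∞). Suppose (Q₀,P₀) ∈ ℂ² with (Q₀,P₀) ≠ (0,0) and q₀, p₀ : (0,∞) → ℂ with f·q₀ integrable satisfy the time-harmonic equations: −iω·Q₀ = −Ω·P₀; −iω·P₀ = Ω·Q₀ − ∫₀^∞ f(x)·q₀(x) dx; −iω·q₀(x) = x·p₀(x) and −iω·p₀(x) = −x·q₀(x) − Q₀·f(x) for almost every x > 0. Then Ω² − ω² = Ω·∫₀^∞ x·f(x)²/(ω²−x²) dx. -/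
open MeasureTheory

/-- Dispersion relation of the Caldeira–Leggett model with a negative-energy
oscillator: any nontrivial time-harmonic solution with frequency `ω`,
`ω² ∉ [0,∞)`, satisfies `Ω² − ω² = Ω·∫₀^∞ x f(x)²/(ω²−x²) dx`. -/
theorem caldeira_leggett_dispersion_relation
    (Ω : ℝ) (hΩ : 0 < Ω) (f : ℝ → ℝ) (ω : ℂ)
    (hω : ¬ ∃ t : ℝ, 0 ≤ t ∧ ω ^ 2 = (t : ℂ))
    (hint : IntegrableOn
      (fun x : ℝ => (x : ℂ) * ((f x : ℂ)) ^ 2 / (ω ^ 2 - (x : ℂ) ^ 2))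
      (Set.Ioi 0))
    (Q₀ P₀ : ℂ) (hQP : (Q₀, P₀) ≠ (0, 0))
    (q₀ p₀ : ℝ → ℂ)
    (hq : IntegrableOn (fun x : ℝ => (f x : ℂ) * q₀ x) (Set.Ioi 0))
    (e1 : -(Complex.I * ω) * Q₀ = -(Ω : ℂ) * P₀)
    (e2 : -(Complex.I * ω) * P₀
      = (Ω : ℂ) * Q₀ - ∫ x in Set.Ioi (0 : ℝ), (f x : ℂ) * q₀ x)
    (e3 : ∀ᵐ x ∂(volume.restrict (Set.Ioi (0 : ℝ))),
      -(Complex.I * ω) * q₀ x = (x : ℂ) * p₀ x ∧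
      -(Complex.I * ω) * p₀ x = -(x : ℂ) * q₀ x - Q₀ * (f x : ℂ)) :
    (Ω : ℂ) ^ 2 - ω ^ 2
      = (Ω : ℂ) * ∫ x in Set.Ioi (0 : ℝ),
          (x : ℂ) * ((f x : ℂ)) ^ 2 / (ω ^ 2 - (x : ℂ) ^ 2) := by
  have hI : Complex.I ^ 2 = -1 := Complex.I_sq
  have hΩ' : (Ω : ℂ) ≠ 0 := by exact_mod_cast hΩ.ne'
  have hQ : Q₀ ≠ 0 := by
    rintro rfl
    have hP : P₀ = 0 := by simpa [hΩ'] using e1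
    exact hQP (by rw [hP])
  have hforce : ∫ x in Set.Ioi (0 : ℝ), (f x : ℂ) * q₀ x
      = Q₀ * ∫ x in Set.Ioi (0 : ℝ),
          (x : ℂ) * ((f x : ℂ)) ^ 2 / (ω ^ 2 - (x : ℂ) ^ 2) := by
    rw [← integral_const_mul]
    refine integral_congr_ae ?_
    filter_upwards [e3] with x ⟨hx₁, hx₂⟩
    have hne : ω ^ 2 - (x : ℂ) ^ 2 ≠ 0 := fun h =>
      hω ⟨x ^ 2, sq_nonneg x, by push_cast; exact sub_eq_zero.mp h⟩
    have hres : (ω ^ 2 - (x : ℂ) ^ 2) * q₀ x = Q₀ * x * f x := by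
      linear_combination Complex.I * ω * hx₁ - (x : ℂ) * hx₂ + ω ^ 2 * q₀ x * hI
    rw [← mul_div_assoc, eq_div_iff hne]
    linear_combination (f x : ℂ) * hres
  rw [hforce] at e2
  refine mul_left_cancel₀ hQ ?_
  linear_combination -(Complex.I * ω) * e1 - (Ω : ℂ) * e2 - ω ^ 2 * Q₀ * hI
end

section
/- Spectral stability of the Caldeira–Leggett model with a positive-energy oscillator: let Ω > 0 and let f : (0,∞) → ℝ be measurable with ∫₀^∞ f(x)²/x dx ≤ Ω. Then there is no ω ∈ ℂ with ω² ∉ [0,∞) satisfying the positive-energy dispersion relation Ω² − ω² = −Ω·∫₀^∞ x·f(x)²/(ω²−x²) dx (the integral being absolutely convergent for such ω). In particular there is no root ω with Im ω ≠ 0, so all time-harmonic solutions are non-growing. -/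
open MeasureTheory

/-- Spectral stability of the Caldeira–Leggett model with a positive-energy
oscillator: if `∫₀^∞ f(x)²/x dx ≤ Ω`, the positive-energy dispersion relation
`Ω² − ω² = −Ω·∫₀^∞ x f(x)²/(ω²−x²) dx` has no root `ω` with `ω² ∉ [0,∞)`. -/
theorem caldeira_leggett_positive_energy_stable
    (Ω : ℝ) (hΩ : 0 < Ω) (f : ℝ → ℝ) (hmeas : Measurable f)
    (hint : IntegrableOn (fun x : ℝ => (f x) ^ 2 / x) (Set.Ioi 0))
    (hbound : (∫ x in Set.Ioi (0 : ℝ), (f x) ^ 2 / x) ≤ Ω) :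
    ¬ ∃ ω : ℂ,
      (¬ ∃ t : ℝ, 0 ≤ t ∧ ω ^ 2 = (t : ℂ)) ∧
      IntegrableOn
        (fun x : ℝ => (x : ℂ) * ((f x : ℂ)) ^ 2 / (ω ^ 2 - (x : ℂ) ^ 2))
        (Set.Ioi 0) ∧
      (Ω : ℂ) ^ 2 - ω ^ 2
        = -(Ω : ℂ) * ∫ x in Set.Ioi (0 : ℝ),
            (x : ℂ) * ((f x : ℂ)) ^ 2 / (ω ^ 2 - (x : ℂ) ^ 2) := by
  rintro ⟨ω, hω, hint', heq⟩
  generalize ω ^ 2 = z at hω hint' heq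
  have him : ∀ x : ℝ, RCLike.im ((x : ℂ) * (f x : ℂ) ^ 2 / (z - (x : ℂ) ^ 2))
      = -z.im * (x * f x ^ 2 / Complex.normSq (z - (x : ℂ) ^ 2)) := by
    intro x
    rw [← Complex.ofReal_pow, ← Complex.ofReal_mul]
    simp only [RCLike.im_to_complex, Complex.div_im, Complex.ofReal_im, Complex.ofReal_re,
      Complex.sub_im, ← Complex.ofReal_pow]
    ring
  have hIim := integral_im hint'
  have hIre := integral_re hint'
  simp only [him, integral_const_mul] at hIim
  have hP : 0 ≤ ∫ x in Set.Ioi (0 : ℝ),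
      x * f x ^ 2 / Complex.normSq (z - (x : ℂ) ^ 2) :=
    setIntegral_nonneg measurableSet_Ioi fun x (hx : 0 < x) =>
      div_nonneg (by positivity) (Complex.normSq_nonneg _)
  have heq_im := congrArg Complex.im heq
  have heq_re := congrArg Complex.re heq
  rw [← Complex.ofReal_pow, ← Complex.ofReal_neg, Complex.im_ofReal_mul, Complex.sub_im,
    Complex.ofReal_im, ← RCLike.im_to_complex (x := ∫ x in _, _), ← hIim] at heq_im
  rw [← Complex.ofReal_pow, ← Complex.ofReal_neg, Complex.re_ofReal_mul, Complex.sub_re,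
    Complex.ofReal_re, ← RCLike.re_to_complex (x := ∫ x in _, _), ← hIre] at heq_re
  have hz_im : z.im = 0 := by
    have hmul : z.im * (1 + Ω * ∫ x in Set.Ioi (0 : ℝ),
        x * f x ^ 2 / Complex.normSq (z - (x : ℂ) ^ 2)) = 0 := by linarith
    exact (mul_eq_zero.mp hmul).resolve_right (by positivity)
  have hz : z = (z.re : ℂ) := Complex.ext rfl hz_im
  have hz_re : z.re < 0 := by
    by_contra! h
    exact hω ⟨z.re, h, hz⟩
  have hle : -∫ x in Set.Ioi (0 : ℝ),
      RCLike.re ((x : ℂ) * (f x : ℂ) ^ 2 / (z - (x : ℂ) ^ 2))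
      ≤ ∫ x in Set.Ioi (0 : ℝ), f x ^ 2 / x := by
    rw [← integral_neg]
    refine setIntegral_mono_on hint'.re.neg hint measurableSet_Ioi fun x (hx : 0 < x) => ?_
    have hre : (x : ℂ) * (f x : ℂ) ^ 2 / (z - (x : ℂ) ^ 2)
        = ((x * f x ^ 2 / (z.re - x ^ 2) : ℝ) : ℂ) := by
      rw [hz]
      push_cast
      rfl
    rw [hre, RCLike.re_to_complex, Complex.ofReal_re, ← div_neg,
      div_le_div_iff₀ (by nlinarith [sq_nonneg x]) hx]
    nlinarith [mul_nonneg (sq_nonneg (f x)) (neg_nonneg.mpr hz_re.le)]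
  nlinarith [mul_le_mul_of_nonneg_left (hle.trans hbound) hΩ.le]
end
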